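/- arXiv:1102.5136 — 3 statements merged into one kernel-verified Lean document; each statement's English description precedes it below -/
import Mathlib

section
/- Let Ξ_g = {Σ_{k≥1} x_k 2^{-k} : x_k ∈ {0,1} and x_k·x_{2k} = 0 for all k ≥ 1} ⊆ [0,1]. Then the Hausdorff dimension of Ξ_g equals -log₂ p, where p is the unique real number in (0,1) satisfying p³ = (1-p)². -/
open scoped Classical ENNReal
open Filter MeasureTheory Topology

noncomputable section

/-- `Begins x u` : the finite word `u` is a prefix of the sequence `x` (indexed by `ℕ+`). -/
def Begins {m : ℕ} (x : ℕ+ → Fin m) (u : List (Fin m)) : Prop :=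
  ∀ j : Fin u.length, x ⟨(j : ℕ) + 1, Nat.succ_pos _⟩ = u.get j

/-- `Cyl u` : the cylinder set of the word `u`. -/
def Cyl {m : ℕ} (u : List (Fin m)) : Set (ℕ+ → Fin m) := {x | Begins x u}

/-- `Pref Ω` : the set of (finite) prefixes of sequences in `Ω`. -/
def Pref {m : ℕ} (Ω : Set (ℕ+ → Fin m)) : Set (List (Fin m)) := {u | ∃ x ∈ Ω, Begins x u}

/-- number of length-`n` words beginning some sequence of `X`. -/
def NWords {m : ℕ} (n : ℕ) (X : Set (ℕ+ → Fin m)) : ℕ :=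
  Set.ncard {u : List (Fin m) | u.length = n ∧ u ∈ Pref X}

/-- restriction of `x` to the geometric progression `J_i = {i, qi, q²i, …}`:
`(x|J_i)_k = x_{q^{k-1} i}` for `k ≥ 1`. -/
def RestrJ {m : ℕ} (q : ℕ+) (x : ℕ+ → Fin m) (i : ℕ+) : ℕ+ → Fin m :=
  fun k => x (q ^ ((k : ℕ) - 1) * i)

/-- the multiplicative subshift `X_Ω = {x : x|J_i ∈ Ω for all i with q ∤ i}`. -/
def XOm {m : ℕ} (q : ℕ+) (Ω : Set (ℕ+ → Fin m)) : Set (ℕ+ → Fin m) :=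
  {x | ∀ i : ℕ+, ¬ q ∣ i → RestrJ q x i ∈ Ω}

/-- the real number `Σ_{k≥1} x_k m^{-k}` with base-`m` digit sequence `x`. -/
def ValMap (m : ℕ) (x : ℕ+ → Fin m) : ℝ := ∑' k : ℕ+, ((x k : ℕ) : ℝ) * (m : ℝ)⁻¹ ^ (k : ℕ)

/-- the subset of `[0,1]` of reals whose base-`m` digit sequence lies in `X`. -/
def XiSet {m : ℕ} (X : Set (ℕ+ → Fin m)) : Set ℝ := {r | ∃ x ∈ X, r = ValMap m x}

/-- entropy (base-`m` logarithms) of the partition of `Ω` into `k`-cylinders, for a measure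
supported on `Ω` (words that are not prefixes of `Ω` get measure `0` and contribute nothing). -/
def Hent (m : ℕ) (μ : Measure (ℕ+ → Fin m)) (k : ℕ) : ℝ :=
  -∑ u : Fin k → Fin m,
    ((μ (Cyl (List.ofFn u))).toReal * Real.logb m (μ (Cyl (List.ofFn u))).toReal)

/-- `s(Ω,μ) = (q-1)² Σ_{k≥1} H_m^μ(α_k)/q^{k+1}`. -/
def sOm (m : ℕ) (q : ℕ+) (μ : Measure (ℕ+ → Fin m)) : ℝ :=
  ((q : ℝ) - 1) ^ 2 * ∑' k : ℕ, Hent m μ (k + 1) / (q : ℝ) ^ (k + 2)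

/-- cylinder determined by the first `n` entries of `x`, i.e. `[x₁…x_n]`. -/
def CylN {m : ℕ} (n : ℕ) (x : ℕ+ → Fin m) : Set (ℕ+ → Fin m) :=
  {y | ∀ k : ℕ+, (k : ℕ) ≤ n → y k = x k}

/-- the cylinder `[u|J_i]` where `u = x₁…x_n`: sequences `y` with
`y_{ℓ+1} = x_{q^ℓ i}` for all `ℓ ≥ 0` with `q^ℓ i ≤ n`. -/
def CylJ {m : ℕ} (q n i : ℕ+) (x : ℕ+ → Fin m) : Set (ℕ+ → Fin m) :=
  {y | ∀ ℓ : ℕ, q ^ ℓ * i ≤ n → y ⟨ℓ + 1, Nat.succ_pos _⟩ = x (q ^ ℓ * i)}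

/-- `P` has the product structure `P[u] = ∏_{i ≤ |u|, q ∤ i} μ[u|J_i]` on cylinders. -/
def ProdProp {m : ℕ} (q : ℕ+) (μ P : Measure (ℕ+ → Fin m)) : Prop :=
  ∀ (n : ℕ+) (x : ℕ+ → Fin m),
    P (CylN (n : ℕ) x) = ∏ i ∈ (Finset.Icc 1 n).filter (fun i => ¬ q ∣ i), μ (CylJ q n i x)

/-- `t` is a `[1, m^{1/(q-1)}]`-valued solution of `t(u)^q = Σ_{j : uj ∈ Pref(Ω)} t(uj)`
on the tree of prefixes of `Ω`. -/
def TSol {m : ℕ} (q : ℕ+) (Ω : Set (ℕ+ → Fin m)) (t : List (Fin m) → ℝ) : Prop :=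
  ∀ u ∈ Pref Ω,
    t u ∈ Set.Icc 1 ((m : ℝ) ^ ((1 : ℝ) / ((q : ℝ) - 1))) ∧
    t u ^ (q : ℕ) =
      ∑ j ∈ Finset.univ.filter (fun j : Fin m => u ++ [j] ∈ Pref Ω), t (u ++ [j])

/-- `μ` has the cylinder values `μ[u₁…u_k] = ∏_{j=1}^k t(u₁…u_j)/t(u₁…u_{j-1})^q`
for prefixes `u` of `Ω`. -/
def CylVals {m : ℕ} (q : ℕ+) (Ω : Set (ℕ+ → Fin m)) (t : List (Fin m) → ℝ)
    (μ : Measure (ℕ+ → Fin m)) : Prop :=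
  ∀ u ∈ Pref Ω,
    μ (Cyl u) =
      ENNReal.ofReal (∏ j ∈ Finset.range u.length, t (u.take (j + 1)) / t (u.take j) ^ (q : ℕ))


namespace GM

/-- position `k` is forced to carry the digit zero -/
def blk (x : ℕ → Bool) (k : ℕ) : Prop := 2 ∣ k ∧ x (k / 2) = true

/-- `x` is obtained from `z` by consuming one letter of `z` at each free position. -/
structure Spec (z x : ℕ → Bool) (c : ℕ → ℕ) : Prop where
  x0 : x 0 = false
  c0 : c 0 = 0
  hb : ∀ k, blk x (k + 1) → x (k + 1) = false ∧ c (k + 1) = c k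
  hu : ∀ k, ¬ blk x (k + 1) → x (k + 1) = z (c k) ∧ c (k + 1) = c k + 1

/-- partial construction -/
def stp (z : ℕ → Bool) : ℕ → (ℕ → Bool) × ℕ
  | 0 => (fun _ => false, 0)
  | n + 1 => if blk (stp z n).1 (n + 1) then stp z n
      else (Function.update (stp z n).1 (n + 1) (z (stp z n).2), (stp z n).2 + 1)

lemma stp_gt (z : ℕ → Bool) (n j : ℕ) (h : n < j) : (stp z n).1 j = false := by
  induction n with
  | zero => rfl
  | succ n ih =>
    rw [stp]
    split_ifs
    · exact ih (by omega)
    · simp only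
      rw [Function.update_of_ne (by omega)]; exact ih (by omega)

lemma stp_le (z : ℕ → Bool) (n j : ℕ) (h : j ≤ n) : (stp z n).1 j = (stp z j).1 j := by
  induction n, h using Nat.le_induction with
  | base => rfl
  | succ n hn ih =>
    rw [← ih, stp]
    split_ifs
    · rfl
    · simp only
      rw [Function.update_of_ne (by omega)]

lemma exists_spec (z : ℕ → Bool) : ∃ x c, Spec z x c := by
  have hblk : ∀ k, blk (fun k => (stp z k).1 k) (k + 1) ↔ blk (stp z k).1 (k + 1) := by
    intro k
    unfold blk
    refine and_congr_right fun h => ?_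
    rw [stp_le z k ((k + 1) / 2) (by omega)]
  refine ⟨fun k => (stp z k).1 k, fun k => (stp z k).2, rfl, rfl, ?_, ?_⟩
  · intro k hk
    rw [hblk] at hk
    simp only [stp, if_pos hk]
    exact ⟨stp_gt z k _ (by omega), trivial⟩
  · intro k hk
    rw [hblk] at hk
    simp only [stp, if_neg hk]
    simp

/-- number of ones -/
def cnt (x : ℕ → Bool) (n : ℕ) : ℕ := ∑ k ∈ Finset.range n, if x (k + 1) then 1 else 0

lemma cnt_succ (x : ℕ → Bool) (n : ℕ) :
    cnt x (n + 1) = cnt x n + if x (n + 1) then 1 else 0 := by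
  rw [cnt, cnt, Finset.sum_range_succ]

lemma cnt_zero (x : ℕ → Bool) : cnt x 0 = 0 := by simp [cnt]

lemma cnt_le (x : ℕ → Bool) (n : ℕ) : cnt x n ≤ n := by
  induction n with
  | zero => simp [cnt]
  | succ n ih => rw [cnt_succ]; split_ifs <;> omega

lemma cnt_half_b (x : ℕ → Bool) (n : ℕ) (h : blk x (n + 1)) :
    cnt x ((n + 1) / 2) = cnt x (n / 2) + 1 := by
  obtain ⟨h1, h2⟩ := h
  have : (n + 1) / 2 = n / 2 + 1 := by omega
  rw [this] at h2 ⊢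
  rw [cnt_succ, h2]; simp

lemma cnt_half_u (x : ℕ → Bool) (n : ℕ) (h : ¬ blk x (n + 1)) :
    cnt x ((n + 1) / 2) = cnt x (n / 2) := by
  unfold blk at h
  by_cases h1 : 2 ∣ n + 1
  · have : (n + 1) / 2 = n / 2 + 1 := by omega
    rw [this] at h ⊢
    rw [cnt_succ]
    have : x (n / 2 + 1) = false := by simpa [h1] using h
    simp [this]
  · have : (n + 1) / 2 = n / 2 := by omega
    rw [this]

/-- number of ones among the first `m` letters of `z` -/
def cz (z : ℕ → Bool) (m : ℕ) : ℕ := ∑ k ∈ Finset.range m, if z k then 1 else 0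

lemma Spec.c_eq {z x c} (h : Spec z x c) (n : ℕ) : c n + cnt x (n / 2) = n := by
  induction n with
  | zero => simp [h.c0, cnt]
  | succ n ih =>
    by_cases hb : blk x (n + 1)
    · rw [(h.hb n hb).2, cnt_half_b x n hb]; omega
    · rw [(h.hu n hb).2, cnt_half_u x n hb]; omega

lemma Spec.cnt_eq {z x c} (h : Spec z x c) (n : ℕ) : cnt x n = cz z (c n) := by
  induction n with
  | zero => simp [h.c0, cnt, cz]
  | succ n ih =>
    rw [cnt_succ]
    by_cases hb : blk x (n + 1)
    · rw [(h.hb n hb).2, (h.hb n hb).1, ih]; simp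
    · rw [(h.hu n hb).2, (h.hu n hb).1, ih, cz, cz, Finset.sum_range_succ]

lemma Spec.adm {z x c} (h : Spec z x c) (k : ℕ) (hk : x k = true) : x (2 * k) = false := by
  obtain rfl | hk0 := Nat.eq_zero_or_pos k
  · exact h.x0
  · obtain ⟨m, hm⟩ : ∃ m, 2 * k = m + 1 := ⟨2 * k - 1, by omega⟩
    rw [hm]
    refine (h.hb m ⟨by omega, ?_⟩).1
    rw [← hm]; simpa using hk

lemma Spec.determined {z x c z' x' c'} (h : Spec z x c) (h' : Spec z' x' c') (n : ℕ)
    (hx : ∀ k, k ≤ n → x k = x' k) : c n = c' n ∧ ∀ i < c n, z i = z' i := by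
  induction n with
  | zero => simp [h.c0, h'.c0]
  | succ n ih =>
    obtain ⟨h1, h2⟩ := ih fun k hk => hx k (by omega)
    have hbb : blk x (n + 1) ↔ blk x' (n + 1) := by
      unfold blk; rw [hx ((n + 1) / 2) (by omega)]
    by_cases hb : blk x (n + 1)
    · have hb' := hbb.1 hb
      rw [(h.hb n hb).2, (h'.hb n hb').2]; exact ⟨h1, h2⟩
    · have hb' : ¬ blk x' (n + 1) := fun hh => hb (hbb.2 hh)
      obtain ⟨e1, e2⟩ := h.hu n hb
      obtain ⟨e3, e4⟩ := h'.hu n hb'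
      rw [e2, e4]
      refine ⟨by omega, fun i hi => ?_⟩
      by_cases hi' : i < c n
      · exact h2 i hi'
      · have : i = c n := by omega
        subst this
        rw [← e1, hx _ le_rfl, e3, h1]

/-- letter weight -/
def bw (p : ℝ) (b : Bool) : ℝ := if b then 1 - p else p

/-- weight of one position -/
def phi (p : ℝ) (x : ℕ → Bool) (k : ℕ) : ℝ :=
  if blk x k then (if x k then 0 else 1) else bw p (x k)

/-- weight of the prefix of length `n` -/
def wt (p : ℝ) (n : ℕ) (x : ℕ → Bool) : ℝ := ∏ k ∈ Finset.range n, phi p x (k + 1)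

lemma wt_succ (p : ℝ) (n : ℕ) (x : ℕ → Bool) : wt p (n + 1) x = wt p n x * phi p x (n + 1) := by
  simp [wt, Finset.prod_range_succ]

lemma Spec.wt_eq {z x c} (h : Spec z x c) (p : ℝ) (n : ℕ) :
    ∏ i ∈ Finset.range (c n), bw p (z i) = wt p n x := by
  induction n with
  | zero => simp [h.c0, wt]
  | succ n ih =>
    rw [wt_succ, ← ih, phi]
    by_cases hb : blk x (n + 1)
    · rw [(h.hb n hb).2, (h.hb n hb).1]; simp [hb]
    · rw [(h.hu n hb).2, (h.hu n hb).1, Finset.prod_range_succ]; simp [hb]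

lemma q_eq {p : ℝ} (hp0 : 0 < p) (hp1 : p < 1) (hp : p ^ 3 = (1 - p) ^ 2) :
    1 - p = p ^ (3 / 2 : ℝ) := by
  have h1 : (p ^ (3 / 2 : ℝ)) ^ 2 = p ^ 3 := by
    rw [← Real.rpow_natCast, ← Real.rpow_mul hp0.le, ← Real.rpow_natCast]; norm_num
  have h2 : 0 < p ^ (3 / 2 : ℝ) := Real.rpow_pos_of_pos hp0 _
  rw [hp] at h1
  nlinarith

lemma wt_rpow {p : ℝ} (hp0 : 0 < p) (hp1 : p < 1) (hp : p ^ 3 = (1 - p) ^ 2) (x : ℕ → Bool)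
    (hx : ∀ k, 1 ≤ k → x k = true → x (2 * k) = false) (n : ℕ) :
    wt p n x = p ^ ((n : ℝ) - cnt x (n / 2) + cnt x n / 2) := by
  induction n with
  | zero => simp [wt, cnt]
  | succ n ih =>
    rw [wt_succ, ih, phi]
    by_cases hb : blk x (n + 1)
    · have hx' : x (n + 1) = false := by
        have := hx ((n + 1) / 2) (by have := hb.1; omega) hb.2
        rwa [Nat.mul_div_cancel' hb.1] at this
      rw [cnt_half_b x n hb, cnt_succ, hx']
      simp only [hb]
      simp
    · rw [cnt_half_u x n hb, cnt_succ]
      simp only [hb, bw]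
      by_cases hx' : x (n + 1) = true
      · simp only [hx']
        simp only [if_true, if_false]
        rw [q_eq hp0 hp1 hp, ← Real.rpow_add hp0]
        congr 1; push_cast; ring
      · simp only [hx']
        simp only [if_false, Bool.false_eq_true]
        rw [← Real.rpow_add_one hp0.ne']
        congr 1; push_cast; ring

/-- sequence attached to a finite set of positions -/
def ofF (u : Finset ℕ) : ℕ → Bool := fun k => decide (k ∈ u)

lemma phi_congr (p : ℝ) (x y : ℕ → Bool) (k : ℕ) (h : ∀ j ≤ k, x j = y j) :
    phi p x k = phi p y k := by
  unfold phi blk; rw [h k le_rfl, h (k / 2) (by omega)]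

lemma wt_congr (p : ℝ) (x y : ℕ → Bool) (n : ℕ) (h : ∀ j ≤ n, x j = y j) :
    wt p n x = wt p n y := by
  unfold wt
  refine Finset.prod_congr rfl fun k hk => phi_congr p x y _ fun j hj => h j ?_
  have := Finset.mem_range.1 hk
  omega

lemma sum_wt (p : ℝ) (n : ℕ) : ∑ u ∈ (Finset.Icc 1 n).powerset, wt p n (ofF u) = 1 := by
  induction n with
  | zero => simp [wt]
  | succ n ih =>
    have hI : Finset.Icc 1 (n + 1) = insert (n + 1) (Finset.Icc 1 n) := by
      ext j; simp; omega
    rw [hI, Finset.sum_powerset_insert (by simp), ← Finset.sum_add_distrib, ← ih]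
    refine Finset.sum_congr rfl fun u hu => ?_
    have hu' : n + 1 ∉ u := fun h => by
      have := Finset.mem_Icc.1 (Finset.mem_powerset.1 hu h); omega
    have e : ∀ j ≤ n, ofF (insert (n + 1) u) j = ofF u j := by
      intro j hj
      have : j ≠ n + 1 := by omega
      simp [ofF, this]
    rw [wt_succ, wt_succ, wt_congr p _ _ n e, ← mul_add]
    have hbb : blk (ofF (insert (n + 1) u)) (n + 1) ↔ blk (ofF u) (n + 1) := by
      unfold blk; rw [e ((n + 1) / 2) (by omega)]
    have e1 : ofF u (n + 1) = false := by simp [ofF, hu']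
    have e2 : ofF (insert (n + 1) u) (n + 1) = true := by simp [ofF]
    unfold phi
    rw [e1, e2]
    by_cases hb : blk (ofF u) (n + 1)
    · simp [hbb, hb]
    · simp [hbb, hb, bw]

lemma wt_nonneg {p : ℝ} (hp0 : 0 < p) (hp1 : p < 1) (n : ℕ) (x : ℕ → Bool) : 0 ≤ wt p n x := by
  unfold wt
  refine Finset.prod_nonneg fun k _ => ?_
  unfold phi bw
  split_ifs <;> linarith

/-- telescoping along powers of two -/
lemma exists_good (x : ℕ → Bool) {ε : ℝ} (hε : 0 < ε) (n0 : ℕ) :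
    ∃ n ≥ n0, (cnt x n : ℝ) / 2 - cnt x (n / 2) ≤ ε * n := by
  by_contra! hcon
  have key : ∀ j : ℕ, 2 * ε * j ≤ (cnt x (2 ^ (n0 + j)) : ℝ) / 2 ^ (n0 + j) := by
    intro j
    induction j with
    | zero => simp; positivity
    | succ j ih =>
      have h1 := hcon (2 ^ (n0 + (j + 1))) (by
        have := (Nat.lt_two_pow_self (n := n0 + (j + 1))); omega)
      have h2 : 2 ^ (n0 + (j + 1)) / 2 = 2 ^ (n0 + j) := by
        rw [← add_assoc, pow_succ]; simp
      rw [h2] at h1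
      have h3 : (0 : ℝ) < 2 ^ (n0 + j) := by positivity
      rw [le_div_iff₀ h3] at ih
      rw [le_div_iff₀ (by positivity)]
      push_cast at h1 ⊢
      rw [← add_assoc, pow_succ] at h1 ⊢
      nlinarith
  obtain ⟨j, hj⟩ := exists_nat_gt (1 / (2 * ε))
  have h1 := key j
  have h2 : (cnt x (2 ^ (n0 + j)) : ℝ) / 2 ^ (n0 + j) ≤ 1 := by
    rw [div_le_one (by positivity)]
    exact_mod_cast cnt_le x _
  rw [div_lt_iff₀ (by positivity)] at hj
  nlinarith

/-- deterministic consequence of the law of large numbers -/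
lemma Spec.lower {z x c} (h : Spec z x c) {p : ℝ} (hp0 : 0 < p) (hp1 : p < 1)
    (hz : Tendsto (fun m : ℕ => (cz z m : ℝ) / m) atTop (𝓝 (1 - p))) {ε : ℝ} (hε : 0 < ε) :
    ∀ᶠ n : ℕ in atTop, -(ε * n) ≤ (cnt x n : ℝ) / 2 - cnt x (n / 2) := by
  set δ := ε / 4 with hδ
  have hδ0 : 0 < δ := by positivity
  obtain ⟨m0, hm0⟩ := Filter.eventually_atTop.1 ((Metric.tendsto_nhds.1 hz) δ hδ0)
  set q := 1 - p with hq
  set L := q / (1 + q / 2) with hL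
  have hq0 : 0 < q := by linarith
  have hL' : L = q - q * L / 2 := by
    have : (1 + q / 2) ≠ 0 := by positivity
    have h1 : L * (1 + q / 2) = q := by rw [hL]; field_simp
    linarith
  have hq1 : q < 1 := by linarith
  have hL0 : 0 ≤ L := by positivity
  have hL1 : L ≤ 1 := by rw [hL, div_le_one (by positivity)]; linarith
  -- recursive estimate
  have hrec : ∀ n : ℕ, 2 * m0 + 2 ≤ n →
      |(cnt x n : ℝ) - L * n| ≤ q * |(cnt x (n / 2) : ℝ) - L * (n / 2 : ℕ)| + 1 + δ * n := by
    intro n hn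
    have hc := h.c_eq n
    have hle := cnt_le x (n / 2)
    have hcm : m0 ≤ c n := by omega
    have hc0 : 0 < c n := by omega
    have hcn : c n ≤ n := by omega
    have h1 := hm0 (c n) hcm
    rw [Real.dist_eq, ← h.cnt_eq] at h1
    have hc0' : (0 : ℝ) < c n := by exact_mod_cast hc0
    have hcn' : (c n : ℝ) ≤ n := by exact_mod_cast hcn
    have h2 : |(cnt x n : ℝ) - q * c n| ≤ δ * n := by
      have : (cnt x n : ℝ) - q * c n = ((cnt x n : ℝ) / c n - q) * c n := by field_simp
      rw [this, abs_mul, abs_of_pos hc0']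
      have := abs_nonneg ((cnt x n : ℝ) / c n - q)
      nlinarith
    have hc' : (c n : ℝ) = n - cnt x (n / 2) := by
      have : (c n : ℝ) + cnt x (n / 2) = n := by exact_mod_cast hc
      linarith
    rw [hc'] at h2
    have hfl : (n : ℝ) / 2 - 1 ≤ (n / 2 : ℕ) ∧ ((n / 2 : ℕ) : ℝ) ≤ n / 2 := by
      constructor
      · have : n ≤ 2 * (n / 2) + 1 := by omega
        have : (n : ℝ) ≤ 2 * (n / 2 : ℕ) + 1 := by exact_mod_cast this
        linarith
      · have : 2 * (n / 2) ≤ n := by omega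
        have : 2 * ((n / 2 : ℕ) : ℝ) ≤ n := by exact_mod_cast this
        linarith
    obtain ⟨f1, f2⟩ := hfl
    set E := (cnt x (n / 2) : ℝ) - L * (n / 2 : ℕ) with hE
    set r := (n : ℝ) / 2 - (n / 2 : ℕ) with hr
    have e : (cnt x n : ℝ) - L * n = ((cnt x n : ℝ) - q * (n - cnt x (n / 2))) - q * E
        + q * L * r := by
      rw [hE, hr]
      have : L * n = (q - q * L / 2) * n := by rw [← hL']
      rw [this]; ring
    have hr0 : |q * L * r| ≤ 1 := by
      rw [abs_of_nonneg (by apply mul_nonneg; positivity; linarith)]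
      have : q * L ≤ 1 := by nlinarith
      have : 0 ≤ q * L := by positivity
      nlinarith
    rw [e]
    calc _ ≤ |((cnt x n : ℝ) - q * (n - cnt x (n / 2))) - q * E| + |q * L * r| := abs_add_le _ _
      _ ≤ |((cnt x n : ℝ) - q * (n - cnt x (n / 2)))| + |q * E| + |q * L * r| := by
          gcongr; exact abs_sub _ _
      _ ≤ _ := by rw [abs_mul, abs_of_pos hq0]; linarith
  set K : ℝ := (2 * m0 + 2) + 1 / p with hK
  have hKp : 1 ≤ p * K := by
    rw [hK, mul_add, mul_one_div_cancel hp0.ne']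
    have : 0 ≤ p * (2 * m0 + 2) := by positivity
    linarith
  have hK0 : 0 < K := by positivity
  have hall : ∀ n : ℕ, |(cnt x n : ℝ) - L * n| ≤ K + 2 * δ * n := by
    intro n
    induction n using Nat.strong_induction_on with
    | _ n ih =>
      by_cases hn : 2 * m0 + 2 ≤ n
      · have h1 := hrec n hn
        have h2 := ih (n / 2) (by omega)
        have h3 : ((n / 2 : ℕ) : ℝ) ≤ n / 2 := Nat.cast_div_le
        have h4 : q * |(cnt x (n / 2) : ℝ) - L * (n / 2 : ℕ)| ≤ q * K + δ * n := by
          have : |(cnt x (n / 2) : ℝ) - L * (n / 2 : ℕ)| ≤ K + δ * n := by nlinarith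
          have h5 : 0 ≤ δ * n := by positivity
          nlinarith
        have : q * K + 1 ≤ K := by rw [hq]; linarith
        linarith
      · have h1 : (cnt x n : ℝ) ≤ n := by exact_mod_cast cnt_le x n
        have h2 : (n : ℝ) ≤ 2 * m0 + 2 := by exact_mod_cast (by omega : n ≤ 2 * m0 + 2)
        have h3 : (0 : ℝ) ≤ cnt x n := by positivity
        have h4 : 0 ≤ 2 * δ * n := by positivity
        have h5 : 0 ≤ L * n := by positivity
        have h6 : L * n ≤ n := by nlinarith [(Nat.cast_nonneg n : (0 : ℝ) ≤ n)]
        have h7 : 0 < 1 / p := by positivity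
        rw [abs_le]; constructor <;> linarith
  obtain ⟨n1, hn1⟩ := exists_nat_gt (2 * K / (2 * δ))
  filter_upwards [Filter.eventually_ge_atTop n1] with n hn
  have h1 := (abs_le.1 (hall n)).1
  have h2 := (abs_le.1 (hall (n / 2))).2
  have h3 : ((n / 2 : ℕ) : ℝ) ≤ n / 2 := Nat.cast_div_le
  have h4 : (n1 : ℝ) ≤ n := by exact_mod_cast hn
  rw [div_lt_iff₀ (by positivity)] at hn1
  have h5 : L * ((n / 2 : ℕ) : ℝ) ≤ L * (n / 2) := by gcongr
  have h6 : δ * ((n / 2 : ℕ) : ℝ) ≤ δ * (n / 2) := by gcongr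
  have h7 : n1 * (2 * δ) ≤ n * (2 * δ) := by gcongr
  have h8 : ε = 4 * δ := by rw [hδ]; ring
  rw [h8]
  linarith

/-- digit as a real number -/
def dg (b : Bool) : ℝ := if b then 1 else 0

lemma dg_nonneg (b : Bool) : 0 ≤ dg b := by cases b <;> simp [dg]
lemma dg_le (b : Bool) : dg b ≤ 1 := by cases b <;> simp [dg]

/-- digits as elements of `Fin 2` -/
def ofB (x : ℕ → Bool) : ℕ+ → Fin 2 := fun k => if x k then 1 else 0

/-- value -/
def Val (x : ℕ → Bool) : ℝ := ∑' k : ℕ, dg (x (k + 1)) * (1 / 2) ^ (k + 1)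

lemma valMap_ofB (x : ℕ → Bool) : ValMap 2 (ofB x) = Val x := by
  unfold ValMap Val
  rw [← tsum_pnat_eq_tsum_succ (f := fun k : ℕ => dg (x k) * (1 / 2 : ℝ) ^ k)]
  congr 1; ext k
  congr 1
  · unfold ofB dg; split_ifs <;> simp
  · norm_num

lemma xiSet_eq : XiSet {x : ℕ+ → Fin 2 | ∀ k : ℕ+, (x k : ℕ) * (x (2 * k) : ℕ) = 0} =
    {r | ∃ x : ℕ → Bool, (∀ k, 1 ≤ k → x k = true → x (2 * k) = false) ∧ r = Val x} := by
  ext r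
  constructor
  · rintro ⟨y, hy, rfl⟩
    refine ⟨fun k => if h : 0 < k then decide (y ⟨k, h⟩ = 1) else false, ?_, ?_⟩
    · intro k hk h
      have hk' : 0 < k := hk
      have h2 : 0 < 2 * k := by omega
      simp only [hk', dif_pos, decide_eq_true_eq] at h
      simp only [h2, dif_pos, decide_eq_false_iff_not]
      intro h3
      have := hy ⟨k, hk'⟩
      rw [h, show (2 * ⟨k, hk'⟩ : ℕ+) = ⟨2 * k, h2⟩ from rfl, h3] at this
      simp at this
    · rw [← valMap_ofB]
      congr 1
      ext k
      unfold ofB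
      have := k.pos
      simp only [this, dif_pos, decide_eq_true_eq]
      have e : (⟨(k : ℕ), this⟩ : ℕ+) = k := rfl
      rw [e]
      generalize y k = b
      fin_cases b <;> simp
  · rintro ⟨x, hx, rfl⟩
    refine ⟨ofB x, ?_, (valMap_ofB x).symm⟩
    intro k
    unfold ofB
    by_cases h : x k = true
    · have := hx k k.pos h
      simp [this]
    · simp [h]

/-- partial value -/
def Sn (x : ℕ → Bool) (n : ℕ) : ℝ := ∑ k ∈ Finset.range n, dg (x (k + 1)) * (1 / 2) ^ (k + 1)

lemma summ (x : ℕ → Bool) : Summable fun k : ℕ => dg (x (k + 1)) * (1 / 2 : ℝ) ^ (k + 1) := by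
  refine Summable.of_nonneg_of_le (fun k => mul_nonneg (dg_nonneg _) (by positivity))
    (fun k => ?_) ((summable_nat_add_iff 1).2 summable_geometric_two)
  exact mul_le_of_le_one_left (by positivity) (dg_le _)

lemma Sn_le (x : ℕ → Bool) (n : ℕ) : Sn x n ≤ Val x :=
  (summ x).sum_le_tsum _ fun k _ => mul_nonneg (dg_nonneg _) (by positivity)

lemma le_Sn (x : ℕ → Bool) (n : ℕ) : Val x ≤ Sn x n + (1 / 2) ^ n := by
  unfold Val Sn
  rw [← (summ x).sum_add_tsum_nat_add n]
  gcongr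
  have h1 : Summable fun k : ℕ => (1 / 2 : ℝ) ^ (n + 1) * (1 / 2) ^ k :=
    summable_geometric_two.mul_left _
  calc _ ≤ ∑' k : ℕ, (1 / 2 : ℝ) ^ (n + 1) * (1 / 2) ^ k := by
        refine ((summable_nat_add_iff n).2 (summ x)).tsum_le_tsum (fun k => ?_) h1
        rw [← pow_add, show n + 1 + k = k + n + 1 by ring]
        exact mul_le_of_le_one_left (by positivity) (dg_le _)
    _ = (1 / 2) ^ n := by rw [tsum_mul_left, tsum_geometric_two, pow_succ]; ring

/-- integer with the given binary digits -/
def An (x : ℕ → Bool) : ℕ → ℕ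
  | 0 => 0
  | n + 1 => 2 * An x n + if x (n + 1) then 1 else 0

lemma An_eq (x : ℕ → Bool) (n : ℕ) : Sn x n * 2 ^ n = An x n := by
  induction n with
  | zero => simp [Sn, An]
  | succ n ih =>
    rw [An, Sn, Finset.sum_range_succ, ← Sn]
    push_cast
    rw [← ih, add_mul, mul_assoc, ← mul_pow]
    unfold dg
    norm_num
    ring

lemma An_inj (x y : ℕ → Bool) (h0 : x 0 = y 0) (n : ℕ) (h : An x n = An y n) :
    ∀ k, k ≤ n → x k = y k := by
  induction n with
  | zero => intro k hk; rw [Nat.le_zero.1 hk, h0]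
  | succ n ih =>
    rw [An, An] at h
    have h1 : An x n = An y n := by split_ifs at h <;> omega
    have h2 : x (n + 1) = y (n + 1) := by
      rw [h1] at h
      cases hx : x (n + 1) <;> cases hy : y (n + 1) <;> simp_all
    intro k hk
    rcases Nat.le_succ_iff.1 hk with hk | rfl
    · exact ih h1 k hk
    · exact h2

/-- Bernoulli measure -/
def bet (p : ℝ) : Measure Bool :=
  ENNReal.ofReal p • Measure.dirac false + ENNReal.ofReal (1 - p) • Measure.dirac true

lemma bet_sing (p : ℝ) (b : Bool) : bet p {b} = ENNReal.ofReal (bw p b) := by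
  cases b <;> simp [bet, bw]

lemma bet_prob {p : ℝ} (hp0 : 0 < p) (hp1 : p < 1) : IsProbabilityMeasure (bet p) := by
  constructor
  simp only [bet, Measure.add_apply, Measure.smul_apply, measure_univ, smul_eq_mul, mul_one]
  rw [← ENNReal.ofReal_add hp0.le (by linarith)]
  simp

/-- Bernoulli product measure -/
def nu (p : ℝ) : Measure (ℕ → Bool) := Measure.infinitePi fun _ : ℕ => bet p

lemma nu_cyl {p : ℝ} (hp0 : 0 < p) (hp1 : p < 1) (z : ℕ → Bool) (m : ℕ) :
    nu p {z' | ∀ i < m, z i = z' i} = ENNReal.ofReal (∏ i ∈ Finset.range m, bw p (z i)) := by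
  haveI := bet_prob hp0 hp1
  have e : {z' : ℕ → Bool | ∀ i < m, z i = z' i} =
      Set.pi (Finset.range m : Finset ℕ) (fun i => {z i}) := by
    ext z'; simp [Set.mem_pi, eq_comm]
  rw [e, nu, Measure.infinitePi_pi _ (fun i _ => measurableSet_singleton _),
    ENNReal.ofReal_prod_of_nonneg]
  · simp only [bet_sing]
  · intro i _
    unfold bw; split_ifs <;> linarith

lemma slln {p : ℝ} (hp0 : 0 < p) (hp1 : p < 1) :
    ∀ᵐ z ∂(nu p), Tendsto (fun m : ℕ => (cz z m : ℝ) / m) atTop (𝓝 (1 - p)) := by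
  haveI := bet_prob hp0 hp1
  haveI : IsProbabilityMeasure (nu p) := by unfold nu; infer_instance
  have hm : Measurable dg := measurable_of_countable _
  have hmi : ∀ i : ℕ, Measurable fun z : ℕ → Bool => dg (z i) := fun i =>
    hm.comp (measurable_pi_apply i)
  have hmap : ∀ i : ℕ, (nu p).map (fun z : ℕ → Bool => z i) = bet p := fun i =>
    Measure.infinitePi_map_eval _ i
  have key := ProbabilityTheory.strong_law_ae_real (μ := nu p)
    (fun i (z : ℕ → Bool) => dg (z i)) ?_ ?_ ?_
  · have hint : ∫ z, dg (z 0) ∂(nu p) = 1 - p := by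
      have : ∫ z, dg (z 0) ∂(nu p) = ∫ b, dg b ∂(bet p) := by
        rw [← hmap 0, integral_map (measurable_pi_apply 0).aemeasurable
          hm.aestronglyMeasurable]
      rw [this, integral_fintype (by exact .of_finite)]
      have h0 : 0 ≤ 1 - p := by linarith
      simp [Measure.real, bet_sing, bw, dg, h0]
    rw [hint] at key
    filter_upwards [key] with z hz
    convert hz using 3 with m
    simp [cz, dg]
  · refine Integrable.of_bound (hmi 0).aestronglyMeasurable 1 (ae_of_all _ fun z => ?_)
    rw [Real.norm_of_nonneg (dg_nonneg _)]; exact dg_le _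
  · intro i j hij
    have := ProbabilityTheory.iIndepFun_infinitePi (P := fun _ : ℕ => bet p)
      (X := fun _ => dg) (fun _ => hm)
    exact this.indepFun hij
  · intro i
    refine ⟨(hmi i).aemeasurable, (hmi 0).aemeasurable, ?_⟩
    have : ∀ i : ℕ, (nu p).map (fun z : ℕ → Bool => dg (z i)) = (bet p).map dg := fun i => by
      rw [← hmap i, Measure.map_map hm (measurable_pi_apply i)]; rfl
    rw [this, this]

/-- the target set -/
def Xg : Set ℝ :=
  {r | ∃ x : ℕ → Bool, (∀ k, 1 ≤ k → x k = true → x (2 * k) = false) ∧ r = Val x}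

lemma two_rpow {p : ℝ} (hp0 : 0 < p) (t : ℝ) :
    (2 : ℝ) ^ (-(-Real.logb 2 p * t)) = p ^ t := by
  rw [show -(-Real.logb 2 p * t) = Real.logb 2 p * t by ring, Real.rpow_mul (by norm_num),
    Real.rpow_logb (by norm_num) (by norm_num) hp0]

lemma half_pow (j : ℕ) (d : ℝ) : ((1 / 2 : ℝ) ^ j) ^ d = 2 ^ (-(d * j)) := by
  rw [one_div, inv_pow, Real.inv_rpow (by positivity), ← Real.rpow_natCast,
    ← Real.rpow_mul (by norm_num), Real.rpow_neg (by norm_num), mul_comm]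

lemma s_pos {p : ℝ} (hp0 : 0 < p) (hp1 : p < 1) : 0 < -Real.logb 2 p := by
  have := Real.logb_neg (b := 2) (by norm_num) hp0 hp1
  linarith

lemma upper {p : ℝ} (hp0 : 0 < p) (hp1 : p < 1) (hp : p ^ 3 = (1 - p) ^ 2) {d : ℝ}
    (hd : -Real.logb 2 p < d) : Measure.hausdorffMeasure d Xg ≠ ⊤ := by
  set s := -Real.logb 2 p with hs
  have hs0 : 0 < s := s_pos hp0 hp1
  have hd0 : 0 < d := hs0.trans hd
  set ε := (d / s - 1) / 2 with hε
  have hε0 : 0 < ε := by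
    have : 1 < d / s := by rw [lt_div_iff₀ hs0]; linarith
    rw [hε]; linarith
  have hds : d = s * (1 + 2 * ε) := by rw [hε]; field_simp; ring
  let P : ℕ → ℕ → Finset ℕ → Prop := fun n0 j u =>
    n0 ≤ j ∧ u ∈ (Finset.Icc 1 j).powerset ∧ p ^ ((j : ℝ) * (1 + ε)) ≤ wt p j (ofF u)
  let t : ℕ → ℕ × Finset ℕ → Set ℝ := fun n0 i =>
    if P n0 i.1 i.2 then Set.Icc (Sn (ofF i.2) i.1) (Sn (ofF i.2) i.1 + (1 / 2) ^ i.1) else ∅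
  have hdiam : ∀ n0 i, P n0 i.1 i.2 →
      Metric.ediam (t n0 i) = ENNReal.ofReal ((1 / 2) ^ i.1) := by
    intro n0 i h
    simp only [t, if_pos h, Real.ediam_Icc]
    congr 1; ring
  have hdiam0 : ∀ n0 i, ¬ P n0 i.1 i.2 → Metric.ediam (t n0 i) = 0 := by
    intro n0 i h
    simp only [t, if_neg h, Metric.ediam_empty]
  have hmain := Measure.hausdorffMeasure_le_liminf_tsum d Xg (l := atTop)
    (fun n0 : ℕ => ENNReal.ofReal ((1 / 2) ^ n0)) ?_ t ?_ ?_
  · set r := p ^ ε with hr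
    have hr0 : 0 < r := Real.rpow_pos_of_pos hp0 _
    have hr1 : r < 1 := Real.rpow_lt_one hp0.le hp1 hε0
    have hbound : ∀ n0, ∑' i, Metric.ediam (t n0 i) ^ d ≤ ∑' j : ℕ, ENNReal.ofReal (r ^ j) := by
      intro n0
      rw [ENNReal.tsum_prod']
      refine ENNReal.tsum_le_tsum fun j => ?_
      have hle : ∀ u, Metric.ediam (t n0 (j, u)) ^ d ≤
          if u ∈ (Finset.Icc 1 j).powerset then ENNReal.ofReal (r ^ j * wt p j (ofF u)) else 0 := by
        intro u
        by_cases h : P n0 j u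
        · rw [hdiam n0 (j, u) h, if_pos h.2.1, ENNReal.ofReal_rpow_of_pos (by positivity)]
          refine ENNReal.ofReal_le_ofReal ?_
          simp only
          rw [half_pow, hds, mul_assoc, two_rpow hp0]
          calc p ^ ((1 + 2 * ε) * (j : ℝ)) = r ^ j * p ^ ((j : ℝ) * (1 + ε)) := by
                rw [hr, ← Real.rpow_natCast, ← Real.rpow_mul hp0.le, ← Real.rpow_add hp0]
                congr 1; ring
            _ ≤ _ := by gcongr; exact h.2.2
        · rw [hdiam0 n0 (j, u) h, ENNReal.zero_rpow_of_pos hd0]; exact zero_le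
      refine (ENNReal.tsum_le_tsum hle).trans ?_
      rw [tsum_eq_sum (s := (Finset.Icc 1 j).powerset) (fun u hu => if_neg hu)]
      rw [Finset.sum_congr rfl (fun u hu => if_pos hu),
        ← ENNReal.ofReal_sum_of_nonneg (fun u _ => mul_nonneg (by positivity)
          (wt_nonneg hp0 hp1 _ _)), ← Finset.mul_sum, sum_wt, mul_one]
    have hfin : ∑' j : ℕ, ENNReal.ofReal (r ^ j) ≠ ⊤ :=
      (summable_geometric_of_lt_one hr0.le hr1).tsum_ofReal_ne_top
    refine ne_top_of_le_ne_top hfin (hmain.trans ?_)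
    exact Filter.liminf_le_of_frequently_le' (Filter.Frequently.of_forall hbound)
  · have : Tendsto (fun n : ℕ => (1 / 2 : ℝ) ^ n) atTop (𝓝 0) :=
      tendsto_pow_atTop_nhds_zero_of_lt_one (by norm_num) (by norm_num)
    simpa using ENNReal.tendsto_ofReal this
  · refine Filter.Eventually.of_forall fun n0 i => ?_
    by_cases h : P n0 i.1 i.2
    · rw [hdiam n0 i h]
      exact ENNReal.ofReal_le_ofReal
        (pow_le_pow_of_le_one (by norm_num) (by norm_num) h.1)
    · rw [hdiam0 n0 i h]; exact zero_le
  · refine Filter.Eventually.of_forall fun n0 => ?_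
    rintro _ ⟨x, hx, rfl⟩
    obtain ⟨n, hn, hn'⟩ := exists_good x hε0 n0
    set u := (Finset.Icc 1 n).filter fun k => x k = true with hu
    have hux : ∀ k, 1 ≤ k → k ≤ n → ofF u k = x k := by
      intro k h1 h2
      simp [ofF, hu, h1, h2]
    have hphi : wt p n (ofF u) = wt p n x := by
      unfold wt
      refine Finset.prod_congr rfl fun k hk => ?_
      have hk := Finset.mem_range.1 hk
      unfold phi blk
      rw [hux (k + 1) (by omega) (by omega)]
      by_cases h2 : 2 ∣ k + 1
      · rw [hux ((k + 1) / 2) (by omega) (by omega)]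
      · simp [h2]
    have hSn : Sn (ofF u) n = Sn x n := by
      unfold Sn
      refine Finset.sum_congr rfl fun k hk => ?_
      have hk := Finset.mem_range.1 hk
      rw [hux (k + 1) (by omega) (by omega)]
    have hP : P n0 n u := by
      refine ⟨hn, Finset.mem_powerset.2 (Finset.filter_subset _ _), ?_⟩
      rw [hphi, wt_rpow hp0 hp1 hp x hx]
      refine Real.rpow_le_rpow_of_exponent_ge hp0 hp1.le ?_
      linarith
    refine Set.mem_iUnion.2 ⟨(n, u), ?_⟩
    simp only [t, if_pos hP, hSn]
    exact ⟨Sn_le x n, le_Sn x n⟩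

lemma lower {p : ℝ} (hp0 : 0 < p) (hp1 : p < 1) (hp : p ^ 3 = (1 - p) ^ 2) {d : ℝ} (hd0 : 0 < d)
    (hd : d < -Real.logb 2 p) : Measure.hausdorffMeasure d Xg ≠ 0 := by
  set s := -Real.logb 2 p with hs
  have hs0 : 0 < s := s_pos hp0 hp1
  have := bet_prob hp0 hp1
  have : IsProbabilityMeasure (nu p) := by unfold nu; infer_instance
  choose X C hS using exists_spec
  let G : ℕ → Set (ℕ → Bool) := fun N => {z | ∀ n ≥ N, wt p n (X z) ≤ 2 ^ (-(d * n))}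
  -- some `G N` has positive measure
  obtain ⟨N, hN⟩ : ∃ N, nu p (G N) ≠ 0 := by
    by_contra! hcon
    have h0 : nu p (⋃ N, G N) = 0 := measure_iUnion_null hcon
    have h1 : ∀ᵐ z ∂(nu p), z ∈ ⋃ N, G N := by
      filter_upwards [slln hp0 hp1] with z hz
      have hε : 0 < 1 - d / s := by
        have : d / s < 1 := by rw [div_lt_one hs0]; exact hd
        linarith
      obtain ⟨N, hN⟩ := Filter.eventually_atTop.1 ((hS z).lower hp0 hp1 hz hε)
      refine Set.mem_iUnion.2 ⟨N, fun n hn => ?_⟩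
      have h2 := hN n hn
      rw [wt_rpow hp0 hp1 hp (X z) (fun k _ hk => (hS z).adm k hk)]
      have e : d * n = s * (d / s * n) := by field_simp
      rw [e, two_rpow hp0]
      refine Real.rpow_le_rpow_of_exponent_ge hp0 hp1.le ?_
      linarith
    have h2 : nu p (⋃ N, G N)ᶜ = 0 := h1
    have h3 : nu p Set.univ ≤ 0 := by
      rw [← Set.union_compl_self (⋃ N, G N)]
      exact (measure_union_le _ _).trans (by rw [h0, h2]; simp)
    simp at h3
  -- measure of a small set
  have hsmall : ∀ (n : ℕ) (a r : ℝ) (T : Set ℝ), N ≤ n → r ≤ (1 / 2) ^ n →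
      T ⊆ Set.Icc (a - r) (a + r) →
      nu p ((fun z => Val (X z)) ⁻¹' T ∩ G N) ≤ 4 * ENNReal.ofReal (2 ^ (-(d * n))) := by
    intro n a r T hn hr hT
    set A0 : ℕ := ⌈(2 : ℝ) ^ n * (a - r) - 1⌉₊ with hA0
    have hsub : (fun z => Val (X z)) ⁻¹' T ∩ G N ⊆
        ⋃ A ∈ Finset.Icc A0 (A0 + 3), {z | z ∈ G N ∧ An (X z) n = A} := by
      rintro z ⟨hz, hzG⟩
      obtain ⟨h1, h2⟩ := hT hz
      have h3 := Sn_le (X z) n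
      have h4 := le_Sn (X z) n
      have h5 := An_eq (X z) n
      have h6 : (0 : ℝ) < 2 ^ n := by positivity
      have h7 : (1 / 2 : ℝ) ^ n * 2 ^ n = 1 := by rw [← mul_pow]; norm_num
      simp only at h1 h2
      refine Set.mem_iUnion₂.2 ⟨An (X z) n, Finset.mem_Icc.2 ⟨?_, ?_⟩, hzG, rfl⟩
      · rw [hA0, Nat.ceil_le, ← h5]
        nlinarith
      · have h8 := Nat.le_ceil ((2 : ℝ) ^ n * (a - r) - 1)
        rw [← hA0] at h8
        have : (An (X z) n : ℝ) ≤ A0 + 3 := by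
          rw [← h5]
          nlinarith
        exact_mod_cast this
    have hone : ∀ A : ℕ, nu p {z | z ∈ G N ∧ An (X z) n = A} ≤
        ENNReal.ofReal (2 ^ (-(d * n))) := by
      intro A
      rcases Set.eq_empty_or_nonempty {z | z ∈ G N ∧ An (X z) n = A} with he | ⟨z0, hz0, hA⟩
      · rw [he]; simp
      · calc _ ≤ nu p {z' | ∀ i < C z0 n, z0 i = z' i} := by
              refine measure_mono fun z hz => ?_
              refine ((hS z0).determined (hS z) n ?_).2
              refine An_inj _ _ ?_ n ?_
              · rw [(hS z0).x0, (hS z).x0]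
              · rw [hA, hz.2]
          _ = ENNReal.ofReal (wt p n (X z0)) := by rw [nu_cyl hp0 hp1, (hS z0).wt_eq]
          _ ≤ _ := ENNReal.ofReal_le_ofReal (hz0 n hn)
    calc _ ≤ nu p (⋃ A ∈ Finset.Icc A0 (A0 + 3), {z | z ∈ G N ∧ An (X z) n = A}) :=
          measure_mono hsub
      _ ≤ ∑ A ∈ Finset.Icc A0 (A0 + 3), nu p {z | z ∈ G N ∧ An (X z) n = A} :=
          measure_biUnion_finset_le _ _
      _ ≤ ∑ A ∈ Finset.Icc A0 (A0 + 3), ENNReal.ofReal (2 ^ (-(d * n))) :=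
          Finset.sum_le_sum fun A _ => hone A
      _ = _ := by
          rw [Finset.sum_const, Nat.card_Icc, nsmul_eq_mul]
          congr 1
          rw [show A0 + 3 + 1 - A0 = 4 by omega]; norm_num
  set K : ℝ≥0∞ := 4 * ENNReal.ofReal (2 ^ d) with hK
  have hK0 : K ≠ 0 := by
    rw [hK]
    refine mul_ne_zero (by norm_num) ?_
    rw [Ne, ENNReal.ofReal_eq_zero, not_le]; positivity
  have hKt : K ≠ ⊤ := ENNReal.mul_ne_top (by norm_num) ENNReal.ofReal_ne_top
  have hbd : ∀ T : Set ℝ, Metric.ediam T ≤ ENNReal.ofReal ((1 / 2) ^ N) →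
      nu p ((fun z => Val (X z)) ⁻¹' T ∩ G N) ≤ K * Metric.ediam T ^ d := by
    intro T hT
    rcases T.eq_empty_or_nonempty with rfl | ⟨a, ha⟩
    · simp
    have hne : Metric.ediam T ≠ ⊤ := ne_top_of_le_ne_top ENNReal.ofReal_ne_top hT
    set r := (Metric.ediam T).toReal with hr
    have hTr : Metric.ediam T = ENNReal.ofReal r := (ENNReal.ofReal_toReal hne).symm
    have hr0 : 0 ≤ r := ENNReal.toReal_nonneg
    have hTsub : T ⊆ Set.Icc (a - r) (a + r) := by
      intro b hb
      have h1 : edist b a ≤ ENNReal.ofReal r := hTr ▸ Metric.edist_le_ediam_of_mem hb ha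
      rw [edist_dist, ENNReal.ofReal_le_ofReal_iff hr0, Real.dist_eq, abs_le] at h1
      constructor <;> linarith [h1.1, h1.2]
    rw [hTr, ENNReal.ofReal_le_ofReal_iff (by positivity)] at hT
    rcases hr0.eq_or_lt with h0 | hpos
    · have hlim : Tendsto (fun n : ℕ => 4 * ENNReal.ofReal (2 ^ (-(d * n)))) atTop (𝓝 0) := by
        have h1 : Tendsto (fun n : ℕ => ((1 / 2 : ℝ) ^ d) ^ n) atTop (𝓝 0) :=
          tendsto_pow_atTop_nhds_zero_of_lt_one (by positivity)
            (Real.rpow_lt_one (by norm_num) (by norm_num) hd0)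
        have h2 := ENNReal.Tendsto.const_mul (a := 4) (ENNReal.tendsto_ofReal h1)
          (Or.inr (by norm_num))
        simp only [ENNReal.ofReal_zero, mul_zero] at h2
        refine h2.congr fun n => ?_
        rw [← half_pow, ← Real.rpow_natCast, ← Real.rpow_mul (by norm_num),
          ← Real.rpow_natCast, ← Real.rpow_mul (by norm_num), mul_comm d]
      have : nu p ((fun z => Val (X z)) ⁻¹' T ∩ G N) ≤ 0 := by
        refine ge_of_tendsto hlim ?_
        filter_upwards [Filter.eventually_ge_atTop N] with n hn
        exact hsmall n a r T hn (by rw [← h0]; positivity) hTsub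
      exact this.trans zero_le
    · have hr1 : r ≤ 1 := hT.trans (pow_le_one₀ (by norm_num) (by norm_num))
      obtain ⟨n, hn1, hn2⟩ := exists_nat_pow_near_of_lt_one (y := (1 / 2 : ℝ)) hpos hr1
        (by norm_num) (by norm_num)
      have hnN : N ≤ n := by
        by_contra! hlt
        have : (1 / 2 : ℝ) ^ N ≤ (1 / 2) ^ (n + 1) :=
          pow_le_pow_of_le_one (by norm_num) (by norm_num) hlt
        linarith
      refine (hsmall n a r T hnN hn2 hTsub).trans ?_
      rw [hTr, ENNReal.ofReal_rpow_of_pos hpos, hK, mul_assoc,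
        ← ENNReal.ofReal_mul (by positivity)]
      gcongr
      have h1 : ((1 / 2 : ℝ) ^ (n + 1)) ^ d ≤ r ^ d := by gcongr
      calc (2 : ℝ) ^ (-(d * n)) = 2 ^ d * ((1 / 2 : ℝ) ^ (n + 1)) ^ d := by
            rw [half_pow, ← Real.rpow_add (by norm_num)]
            congr 1; push_cast; ring
        _ ≤ _ := by gcongr
  let m : OuterMeasure ℝ := K⁻¹ • OuterMeasure.map (fun z => Val (X z))
    (OuterMeasure.restrict (G N) (nu p).toOuterMeasure)
  have hm : ∀ T, m T = K⁻¹ * nu p ((fun z => Val (X z)) ⁻¹' T ∩ G N) := by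
    intro T; simp [m]
  have hle : m ≤ OuterMeasure.mkMetric fun r : ℝ≥0∞ => r ^ d := by
    refine OuterMeasure.le_mkMetric _ m (ENNReal.ofReal ((1 / 2) ^ N))
      (by rw [ENNReal.ofReal_pos]; positivity) fun T hT => ?_
    rw [hm, ENNReal.inv_mul_le_iff hK0 hKt]
    exact hbd T hT
  have h1 := hle Xg
  rw [OuterMeasure.coe_mkMetric, hm] at h1
  intro h0
  have h2 : K⁻¹ * nu p ((fun z => Val (X z)) ⁻¹' Xg ∩ G N) = 0 := le_antisymm (h1.trans h0.le) zero_le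
  have h3 : (fun z => Val (X z)) ⁻¹' Xg ∩ G N = G N := by
    refine Set.inter_eq_right.2 fun z _ => ?_
    exact ⟨X z, fun k _ hk => (hS z).adm k hk, rfl⟩
  rw [h3, mul_eq_zero] at h2
  rcases h2 with h2 | h2
  · exact ENNReal.inv_ne_zero.2 hKt h2
  · exact hN h2

end GM

/-- **Proposition 1.1, Hausdorff part.** `dim_H(Ξ_g) = -log₂ p` where `p³ = (1-p)²`,
`0 < p < 1`. -/
theorem stmt4 (p : ℝ) (hp0 : 0 < p) (hp1 : p < 1) (hp : p ^ 3 = (1 - p) ^ 2) :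
    dimH (XiSet {x : ℕ+ → Fin 2 | ∀ k : ℕ+, (x k : ℕ) * (x (2 * k) : ℕ) = 0}) =
      ENNReal.ofReal (-Real.logb 2 p) := by
  rw [GM.xiSet_eq]
  change dimH GM.Xg = _
  have hs0 := GM.s_pos hp0 hp1
  apply le_antisymm
  · refine le_of_forall_gt fun a ha => ?_
    obtain ⟨b, hb1, hb2⟩ := ENNReal.lt_iff_exists_nnreal_btwn.1 ha
    refine lt_of_le_of_lt (dimH_le_of_hausdorffMeasure_ne_top (d := b) ?_) hb2
    refine GM.upper hp0 hp1 hp ?_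
    rw [← ENNReal.ofReal_coe_nnreal] at hb1
    exact (ENNReal.ofReal_lt_ofReal_iff_of_nonneg hs0.le).1 hb1
  · refine le_of_forall_lt fun a ha => ?_
    obtain ⟨b, hb1, hb2⟩ := ENNReal.lt_iff_exists_nnreal_btwn.1 ha
    refine lt_of_lt_of_le hb1 (le_dimH_of_hausdorffMeasure_ne_zero (d := b) ?_)
    have hb0 : 0 < b := by
      have : (0 : ℝ≥0∞) < b := lt_of_le_of_lt zero_le hb1
      exact_mod_cast this
    refine GM.lower hp0 hp1 hp (by exact_mod_cast hb0) ?_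
    rw [← ENNReal.ofReal_coe_nnreal] at hb2
    exact (ENNReal.ofReal_lt_ofReal_iff hs0).1 hb2
end
end

section
/- Let Ξ_g = {Σ_{k≥1} x_k 2^{-k} : x_k ∈ {0,1} and x_k·x_{2k} = 0 for all k ≥ 1} ⊆ [0,1], and let X_g = {(x_k)_{k≥1} ∈ {0,1}^{ℕ⁺} : x_k x_{2k} = 0 for all k}. Then the Minkowski dimension of X_g exists and equals Σ_{k=1}^∞ log₂(F_{k+1}) / 2^{k+1}, where F_1 = 1, F_2 = 2 and F_{k+1} = F_k + F_{k-1} are the Fibonacci numbers; moreover the Hausdorff dimension of Ξ_g is strictly smaller than this Minkowski dimension. -/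
open scoped Classical ENNReal
open Filter MeasureTheory Topology

noncomputable section

namespace GM

def legal (S : Finset ℕ) : Prop := ∀ k ∈ S, 2 * k ∉ S

def CC (U : Finset ℕ) : ℕ := (U.powerset.filter legal).card

lemma CC_mul (U V : Finset ℕ) (hd : Disjoint U V) (h1 : ∀ a ∈ U, 2 * a ∉ V)
    (h2 : ∀ a ∈ V, 2 * a ∉ U) : CC (U ∪ V) = CC U * CC V := by
  unfold CC
  rw [← Finset.card_product]
  have hd' := Finset.disjoint_left.1 hd
  refine Finset.card_nbij' (fun S => (S ∩ U, S ∩ V)) (fun p => p.1 ∪ p.2) ?_ ?_ ?_ ?_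
  · intro S hS
    simp only [Finset.coe_filter, Finset.mem_powerset, Set.mem_ofPred_eq] at hS
    simp only [Finset.coe_product, Finset.coe_filter, Finset.mem_powerset, Set.mem_prod,
      Set.mem_ofPred_eq]
    refine ⟨⟨Finset.inter_subset_right, ?_⟩, Finset.inter_subset_right, ?_⟩ <;>
    · intro k hk h2k
      exact hS.2 k (Finset.mem_inter.1 hk).1 (Finset.mem_inter.1 h2k).1
  · rintro ⟨A, B⟩ hS
    simp only [Finset.coe_product, Finset.coe_filter, Finset.mem_powerset, Set.mem_prod,
      Set.mem_ofPred_eq] at hS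
    simp only [Finset.coe_filter, Finset.mem_powerset, Set.mem_ofPred_eq]
    obtain ⟨⟨hA, lA⟩, hB, lB⟩ := hS
    refine ⟨Finset.union_subset_union hA hB, ?_⟩
    intro k hk h2k
    rcases Finset.mem_union.1 hk with hk | hk <;> rcases Finset.mem_union.1 h2k with h | h
    · exact lA k hk h
    · exact h1 k (hA hk) (hB h)
    · exact h2 k (hB hk) (hA h)
    · exact lB k hk h
  · intro S hS
    simp only [Finset.coe_filter, Finset.mem_powerset, Set.mem_ofPred_eq] at hS
    simp only [← Finset.inter_union_distrib_left]
    exact Finset.inter_eq_left.2 hS.1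
  · rintro ⟨A, B⟩ hS
    simp only [Finset.coe_product, Finset.coe_filter, Finset.mem_powerset, Set.mem_prod,
      Set.mem_ofPred_eq] at hS
    obtain ⟨⟨hA, lA⟩, hB, lB⟩ := hS
    ext k
    · simp only [Finset.mem_inter, Finset.mem_union]
      have := @hA k; have := @hB k; have := @hd' k
      tauto
    · simp only [Finset.mem_inter, Finset.mem_union]
      have := @hA k; have := @hB k; have := @hd' k
      tauto

lemma CC_sum (U : Finset ℕ) : CC U = ∑ S ∈ U.powerset, if legal S then 1 else 0 := by
  unfold CC
  rw [Finset.card_filter]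

def chain (i k : ℕ) : Finset ℕ := (Finset.range k).image (fun l => 2 ^ l * i)

lemma mem_chain {i k a : ℕ} : a ∈ chain i k ↔ ∃ l < k, 2 ^ l * i = a := by
  simp [chain]

lemma chain_succ (i k : ℕ) : chain i (k + 1) = insert (2 ^ k * i) (chain i k) := by
  simp [chain, Finset.range_add_one, Finset.image_insert]

lemma pow_mul_inj {i a b : ℕ} (hi : 0 < i) (h : 2 ^ a * i = 2 ^ b * i) : a = b :=
  Nat.pow_right_injective (le_refl 2) (Nat.eq_of_mul_eq_mul_right hi h)

lemma notMem_chain {i k m : ℕ} (hi : 0 < i) (h : k ≤ m) : 2 ^ m * i ∉ chain i k := by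
  rw [mem_chain]
  rintro ⟨l, hl, e⟩
  have := pow_mul_inj hi e
  omega

lemma CC_chain_rec (i k : ℕ) (hi : 0 < i) :
    CC (chain i (k + 2)) = CC (chain i (k + 1)) + CC (chain i k) := by
  rw [CC_sum, chain_succ i (k + 1), Finset.sum_powerset_insert (notMem_chain hi le_rfl), ← CC_sum]
  congr 1
  rw [CC_sum, chain_succ i k, Finset.sum_powerset_insert (notMem_chain hi le_rfl)]
  have z : ∑ t ∈ (chain i k).powerset,
      (if legal (insert (2 ^ (k + 1) * i) (insert (2 ^ k * i) t)) then 1 else 0) = 0 := by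
    apply Finset.sum_eq_zero
    intro t _
    rw [if_neg]
    intro h
    apply h (2 ^ k * i) (by simp)
    rw [show 2 * (2 ^ k * i) = 2 ^ (k + 1) * i by ring]
    simp
  rw [z, add_zero]
  apply Finset.sum_congr rfl
  intro t ht
  rw [Finset.mem_powerset] at ht
  congr 1
  rw [eq_iff_iff]
  constructor
  · intro h a ha h2
    exact h a (Finset.mem_insert_of_mem ha) (Finset.mem_insert_of_mem h2)
  · intro h a ha h2
    rw [Finset.mem_insert] at ha h2
    rcases ha with rfl | ha
    · rw [show 2 * (2 ^ (k + 1) * i) = 2 ^ (k + 2) * i by ring] at h2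
      rcases h2 with h2 | h2
      · have := pow_mul_inj hi h2
        omega
      · exact notMem_chain hi (by omega) (ht h2)
    · rcases h2 with h2 | h2
      · have : a = 2 ^ k * i := by
          have : 2 * a = 2 * (2 ^ k * i) := by rw [h2]; ring
          omega
        subst this
        exact notMem_chain hi le_rfl (ht ha)
      · exact h a ha h2

lemma CC_chain (F : ℕ → ℕ) (hF1 : F 1 = 1) (hF2 : F 2 = 2)
    (hFrec : ∀ k, 1 ≤ k → F (k + 2) = F (k + 1) + F k) (i : ℕ) (hi : 0 < i) (k : ℕ) :
    CC (chain i k) = F (k + 1) := by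
  induction k using Nat.strong_induction_on with
  | _ k ih =>
    match k with
    | 0 => 
      rw [hF1, CC_sum]
      simp [chain, legal]
    | 1 => 
      rw [hF2, CC_sum, chain_succ, Finset.sum_powerset_insert (notMem_chain hi le_rfl)]
      have : i ≠ 0 := by omega
      have e : chain i 0 = ∅ := rfl
      rw [e, Finset.powerset_empty, Finset.sum_singleton, Finset.sum_singleton]
      rw [if_pos (by simp [legal]), if_pos (by simp [legal, this])]
    | k + 2 =>
      rw [CC_chain_rec i k hi, ih (k + 1) (by omega), ih k (by omega), hFrec (k + 1) (by omega)]

lemma CC_step (F : ℕ → ℕ) (hF1 : F 1 = 1) (hF2 : F 2 = 2)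
    (hFrec : ∀ k, 1 ≤ k → F (k + 2) = F (k + 1) + F k) (n v i : ℕ) (hi : ¬ 2 ∣ i)
    (hn : n + 1 = 2 ^ v * i) :
    CC (Finset.Icc 1 (n + 1)) * F (v + 1) = CC (Finset.Icc 1 n) * F (v + 2) := by
  have hi0 : 0 < i := by
    rcases Nat.eq_zero_or_pos i with h | h
    · subst h; simp at hi
    · exact h
  have hsub : chain i v ⊆ Finset.Icc 1 n := by
    intro a ha
    obtain ⟨l, hl, rfl⟩ := mem_chain.1 ha
    rw [Finset.mem_Icc]
    have h1 : 0 < 2 ^ l * i := by positivity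
    have h2 : 2 ^ l * i < 2 ^ v * i :=
      Nat.mul_lt_mul_of_pos_right (Nat.pow_lt_pow_right (by norm_num) hl) hi0
    omega
  have key : ∀ w, w = v ∨ w = v + 1 → CC ((Finset.Icc 1 n \ chain i v) ∪ chain i w) =
      CC (Finset.Icc 1 n \ chain i v) * CC (chain i w) := by
    intro w hw
    apply CC_mul
    · rw [Finset.disjoint_right]
      intro a ha h
      obtain ⟨l, hl, rfl⟩ := mem_chain.1 ha
      rw [Finset.mem_sdiff, Finset.mem_Icc, mem_chain] at h
      by_cases hlv : l < v
      · exact h.2 ⟨l, hlv, rfl⟩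
      · have : l = v := by omega
        subst this
        omega
    · intro a ha h
      obtain ⟨l, hl, e⟩ := mem_chain.1 h
      rw [Finset.mem_sdiff, Finset.mem_Icc, mem_chain] at ha
      rcases l with _ | l
      · apply hi
        exact ⟨a, by simpa using e⟩
      · apply ha.2
        refine ⟨l, by omega, ?_⟩
        have : 2 * (2 ^ l * i) = 2 * a := by rw [← e]; ring
        omega
    · intro a ha h
      obtain ⟨l, hl, rfl⟩ := mem_chain.1 ha
      rw [show 2 * (2 ^ l * i) = 2 ^ (l + 1) * i by ring, Finset.mem_sdiff, Finset.mem_Icc,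
        mem_chain] at h
      by_cases hlv : l + 1 < v
      · exact h.2 ⟨_, hlv, rfl⟩
      · have : 2 ^ v * i ≤ 2 ^ (l + 1) * i :=
          Nat.mul_le_mul_right _ (Nat.pow_le_pow_right (by norm_num) (by omega))
        omega
  have e1 : (Finset.Icc 1 n \ chain i v) ∪ chain i v = Finset.Icc 1 n :=
    Finset.sdiff_union_of_subset hsub
  have e2 : (Finset.Icc 1 n \ chain i v) ∪ chain i (v + 1) = Finset.Icc 1 (n + 1) := by
    rw [chain_succ, Finset.union_insert, e1, ← hn]
    ext a; simp; omega
  have k1 := key v (Or.inl rfl)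
  have k2 := key (v + 1) (Or.inr rfl)
  rw [e1, CC_chain F hF1 hF2 hFrec i hi0] at k1
  rw [e2, CC_chain F hF1 hF2 hFrec i hi0] at k2
  rw [k1, k2]; ring

/-! ### Sequences and prefixes -/

abbrev XX : Set (ℕ+ → Fin 2) := {x | ∀ k : ℕ+, (x k : ℕ) * (x (2 * k) : ℕ) = 0}

def pre (n : ℕ) (x : ℕ+ → Fin 2) : Finset ℕ :=
  (Finset.Icc 1 n).filter (fun k => ∃ h : 0 < k, x ⟨k, h⟩ = 1)

lemma mem_pre {n k : ℕ} {x : ℕ+ → Fin 2} :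
    k ∈ pre n x ↔ k ≤ n ∧ ∃ h : 0 < k, x ⟨k, h⟩ = 1 := by
  simp only [pre, Finset.mem_filter, Finset.mem_Icc]
  constructor
  · rintro ⟨h, h'⟩; exact ⟨h.2, h'⟩
  · rintro ⟨h, h', h''⟩; exact ⟨⟨h', h⟩, h', h''⟩

lemma pre_legal (n : ℕ) (x : ℕ+ → Fin 2) (hx : x ∈ XX) : legal (pre n x) := by
  intro k hk h2
  rw [mem_pre] at hk h2
  obtain ⟨_, h, e⟩ := hk
  obtain ⟨_, h', e'⟩ := h2
  have := hx ⟨k, h⟩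
  rw [e, show (2 * ⟨k, h⟩ : ℕ+) = ⟨2 * k, h'⟩ from rfl, e'] at this
  simp at this

lemma pre_mem (n : ℕ) (x : ℕ+ → Fin 2) (hx : x ∈ XX) :
    pre n x ∈ (Finset.Icc 1 n).powerset.filter legal := by
  rw [Finset.mem_filter, Finset.mem_powerset]
  exact ⟨Finset.filter_subset _ _, pre_legal n x hx⟩

def toW (n : ℕ) (S : Finset ℕ) : List (Fin 2) :=
  List.ofFn (fun j : Fin n => if (j : ℕ) + 1 ∈ S then (1 : Fin 2) else 0)

lemma NWords_eq (n : ℕ) : NWords n XX = CC (Finset.Icc 1 n) := by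
  unfold NWords CC
  have : {u : List (Fin 2) | u.length = n ∧ u ∈ Pref XX} =
      (toW n) '' ((Finset.Icc 1 n).powerset.filter legal : Finset (Finset ℕ)) := by
    ext u
    simp only [Set.mem_ofPred_eq, Set.mem_image]
    constructor
    · rintro ⟨rfl, x, hx, hb⟩
      refine ⟨pre u.length x, pre_mem _ x hx, ?_⟩
      apply List.ext_get
      · simp [toW]
      · intro j h1 h2
        have := hb ⟨j, h2⟩
        rw [← this]
        simp only [toW, List.get_ofFn, mem_pre, Fin.val_cast]
        by_cases e : x ⟨j + 1, Nat.succ_pos _⟩ = 1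
        · rw [e, if_pos ⟨by omega, Nat.succ_pos _, e⟩]
        · have e0 : x ⟨j + 1, Nat.succ_pos _⟩ = 0 := by
            generalize x ⟨j + 1, Nat.succ_pos _⟩ = y at e
            revert e; revert y; decide
          rw [e0, if_neg]
          rintro ⟨_, _, h⟩
          exact e h
    · rintro ⟨S, hS, rfl⟩
      refine ⟨by simp [toW], fun k => if (k : ℕ) ∈ S then 1 else 0, ?_, ?_⟩
      · intro k
        rw [Finset.mem_coe, Finset.mem_filter] at hS
        have := hS.2 k
        by_cases h : (k : ℕ) ∈ S
        · simp [h, this h]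
        · simp [h]
      · intro j
        exact (List.get_ofFn (fun j : Fin n => if (j : ℕ) + 1 ∈ S then (1 : Fin 2) else 0) j).symm
  rw [this, Set.InjOn.ncard_image, Set.ncard_coe_finset]
  intro S hS T hT h
  have h' := List.ofFn_injective h
  rw [Finset.mem_coe, Finset.mem_filter, Finset.mem_powerset] at hS hT
  have aux : ∀ k, 1 ≤ k → k ≤ n → (k ∈ S ↔ k ∈ T) := by
    intro k hk hkn
    have := congrFun h' ⟨k - 1, by omega⟩
    simp only [Nat.sub_add_cancel hk] at this
    by_cases h1 : k ∈ S <;> by_cases h2 : k ∈ T <;> simp_all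
  ext k
  constructor
  · intro hk
    have := Finset.mem_Icc.1 (hS.1 hk)
    exact (aux k this.1 this.2).1 hk
  · intro hk
    have := Finset.mem_Icc.1 (hT.1 hk)
    exact (aux k this.1 this.2).2 hk

/-! ### Minkowski dimension -/

section Mink

lemma F_bounds (F : ℕ → ℕ) (hF1 : F 1 = 1) (hF2 : F 2 = 2)
    (hFrec : ∀ k, 1 ≤ k → F (k + 2) = F (k + 1) + F k) (k : ℕ) :
    1 ≤ F (k + 1) ∧ F (k + 1) ≤ F (k + 2) ∧ F (k + 2) ≤ 2 * F (k + 1) := by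
  induction k with
  | zero => simp [hF1, hF2]
  | succ k ih =>
    have := hFrec (k + 1) (by omega)
    simp only [add_assoc] at *
    norm_num at *
    omega

lemma F_pow (F : ℕ → ℕ) (hF1 : F 1 = 1) (hF2 : F 2 = 2)
    (hFrec : ∀ k, 1 ≤ k → F (k + 2) = F (k + 1) + F k) (k : ℕ) : F (k + 1) ≤ 2 ^ k := by
  induction k with
  | zero => simp [hF1]
  | succ k ih =>
    have := (F_bounds F hF1 hF2 hFrec k).2.2
    rw [pow_succ]; simp only [add_assoc] at *; norm_num at *; omega

lemma L_bounds (F : ℕ → ℕ) (hF1 : F 1 = 1) (hF2 : F 2 = 2)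
    (hFrec : ∀ k, 1 ≤ k → F (k + 2) = F (k + 1) + F k) (k : ℕ) :
    0 ≤ Real.logb 2 (F (k + 1)) ∧ Real.logb 2 (F (k + 1)) ≤ k ∧
    0 ≤ Real.logb 2 (F (k + 2)) - Real.logb 2 (F (k + 1)) ∧
    Real.logb 2 (F (k + 2)) - Real.logb 2 (F (k + 1)) ≤ 1 := by
  obtain ⟨h1, h2, h3⟩ := F_bounds F hF1 hF2 hFrec k
  have h4 := F_pow F hF1 hF2 hFrec k
  have r1 : (1 : ℝ) ≤ F (k + 1) := by exact_mod_cast h1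
  have r2 : (F (k + 1) : ℝ) ≤ F (k + 2) := by exact_mod_cast h2
  have r3 : (F (k + 2) : ℝ) ≤ 2 * F (k + 1) := by exact_mod_cast h3
  have r4 : (F (k + 1) : ℝ) ≤ 2 ^ k := by exact_mod_cast h4
  refine ⟨Real.logb_nonneg (by norm_num) r1, ?_, ?_, ?_⟩
  · have := Real.logb_le_logb_of_le (b := 2) (by norm_num) (by linarith) r4
    rw [Real.logb_pow] at this
    simpa using this
  · have := Real.logb_le_logb_of_le (b := 2) (by norm_num) (by linarith) r2
    linarith
  · have := Real.logb_le_logb_of_le (b := 2) (by norm_num) (by linarith) r3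
    rw [Real.logb_mul (by norm_num) (by linarith)] at this
    simp at this
    linarith

lemma CC_pos (n : ℕ) : 0 < CC (Finset.Icc 1 n) := by
  unfold CC
  rw [Finset.card_pos]
  exact ⟨∅, by simp [legal]⟩

lemma hasSum_log (F : ℕ → ℕ) (hF1 : F 1 = 1) (hF2 : F 2 = 2)
    (hFrec : ∀ k, 1 ≤ k → F (k + 2) = F (k + 1) + F k) (n : ℕ) :
    HasSum (fun k : ℕ => (Real.logb 2 (F (k + 2)) - Real.logb 2 (F (k + 1))) *
      (((n / 2 ^ k : ℕ) : ℝ) - ((n / 2 ^ (k + 1) : ℕ) : ℝ)))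
      (Real.logb 2 (CC (Finset.Icc 1 n))) := by
  induction n with
  | zero =>
    have : CC (Finset.Icc 1 0) = 1 := by
      rw [CC_sum]; simp [legal]
    rw [this]
    simp [hasSum_zero]
  | succ n ih =>
    obtain ⟨v, i, hi, hn⟩ := Nat.exists_eq_pow_mul_and_not_dvd (Nat.succ_ne_zero n) 2 (by norm_num)
    have hdvd : ∀ k, 2 ^ k ∣ n + 1 ↔ k ≤ v := by
      intro k
      rw [show n + 1 = 2 ^ v * i from hn]
      constructor
      · intro h
        by_contra hk
        have h2 : 2 ^ (v + 1) ∣ 2 ^ v * i := (pow_dvd_pow 2 (by omega)).trans h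
        rw [pow_succ] at h2
        exact hi ((Nat.mul_dvd_mul_iff_left (by positivity)).1 h2)
      · intro h
        exact (pow_dvd_pow 2 h).trans (dvd_mul_right _ _)
    have step := CC_step F hF1 hF2 hFrec n v i hi hn
    have e : Real.logb 2 (CC (Finset.Icc 1 (n + 1))) = Real.logb 2 (CC (Finset.Icc 1 n)) +
        (Real.logb 2 (F (v + 2)) - Real.logb 2 (F (v + 1))) := by
      have p1 := CC_pos n
      have p2 := CC_pos (n + 1)
      have p3 := (F_bounds F hF1 hF2 hFrec v).1
      have p4 := (F_bounds F hF1 hF2 hFrec (v + 1)).1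
      have q1 : (CC (Finset.Icc 1 n) : ℝ) ≠ 0 := by positivity
      have q2 : (CC (Finset.Icc 1 (n + 1)) : ℝ) ≠ 0 := by positivity
      have q3 : (F (v + 1) : ℝ) ≠ 0 := by positivity
      have q4 : (F (v + 2) : ℝ) ≠ 0 := by
        have : 0 < F (v + 2) := p4
        positivity
      have s' : (CC (Finset.Icc 1 (n + 1)) : ℝ) * F (v + 1) = CC (Finset.Icc 1 n) * F (v + 2) := by
        exact_mod_cast step
      have := congrArg (Real.logb 2) s'
      rw [Real.logb_mul q2 q3, Real.logb_mul q1 q4] at this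
      linarith
    rw [e]
    have h2 := hasSum_ite_eq v (Real.logb 2 (F (v + 2)) - Real.logb 2 (F (v + 1)))
    convert ih.add h2 using 1
    funext k
    rw [Nat.succ_div, Nat.succ_div]
    simp only [hdvd]
    by_cases hk : k = v
    · subst hk
      simp
      ring
    · rw [if_neg hk]
      by_cases hk2 : k ≤ v
      · rw [if_pos hk2, if_pos (by omega)]
        push_cast; ring
      · rw [if_neg hk2, if_neg (by omega)]
        push_cast; ring

lemma tendsto_div (k : ℕ) :
    Tendsto (fun n : ℕ => ((n / 2 ^ k : ℕ) : ℝ) / n) atTop (𝓝 ((1 / 2) ^ k)) := by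
  have h := (tendsto_nat_floor_mul_div_atTop (R := ℝ) (a := (1 / 2) ^ k) (by positivity)).comp
    (tendsto_natCast_atTop_atTop (R := ℝ))
  refine h.congr ?_
  intro n
  simp only [Function.comp]
  congr 2
  rw [← Nat.floor_div_eq_div (K := ℝ)]
  congr 1
  push_cast
  rw [one_div, inv_pow]
  field_simp

lemma summable_L (F : ℕ → ℕ) (hF1 : F 1 = 1) (hF2 : F 2 = 2)
    (hFrec : ∀ k, 1 ≤ k → F (k + 2) = F (k + 1) + F k) :
    Summable (fun k : ℕ => Real.logb 2 (F (k + 1)) / 2 ^ (k + 1)) := by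
  have h : Summable (fun k : ℕ => (k : ℝ) ^ 1 * (1 / 2 : ℝ) ^ k) :=
    summable_pow_mul_geometric_of_norm_lt_one 1 (by norm_num)
  refine Summable.of_nonneg_of_le ?_ ?_ h
  · intro k
    have := (L_bounds F hF1 hF2 hFrec k).1
    positivity
  · intro k
    obtain ⟨h0, h1, -⟩ := L_bounds F hF1 hF2 hFrec k
    rw [pow_one, one_div, inv_pow, ← div_eq_mul_inv]
    apply div_le_div₀ (by positivity) h1 (by positivity)
    exact pow_le_pow_right₀ (by norm_num) (by omega)

lemma mink (F : ℕ → ℕ) (hF1 : F 1 = 1) (hF2 : F 2 = 2)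
    (hFrec : ∀ k, 1 ≤ k → F (k + 2) = F (k + 1) + F k) :
    Tendsto (fun n : ℕ => Real.logb 2 (NWords n XX) / n) atTop
      (𝓝 (∑' k : ℕ, Real.logb 2 (F (k + 2)) / 2 ^ (k + 2))) := by
  have hS := summable_L F hF1 hF2 hFrec
  have hS' : Summable (fun k : ℕ => Real.logb 2 (F (k + 2)) / 2 ^ (k + 2)) :=
    (summable_nat_add_iff 1).2 hS
  have e : ∑' k : ℕ, Real.logb 2 (F (k + 2)) / 2 ^ (k + 2) =
      ∑' k : ℕ, (Real.logb 2 (F (k + 2)) - Real.logb 2 (F (k + 1))) *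
        ((1 / 2 : ℝ) ^ k - (1 / 2) ^ (k + 1)) := by
    have h0 := hS.tsum_eq_zero_add
    simp only [zero_add, hF1, Nat.cast_one, Real.logb_one, zero_div] at h0
    have h1 : ∑' k : ℕ, (Real.logb 2 (F (k + 2)) - Real.logb 2 (F (k + 1))) *
        ((1 / 2 : ℝ) ^ k - (1 / 2) ^ (k + 1)) =
        ∑' k : ℕ, (2 * (Real.logb 2 (F (k + 2)) / 2 ^ (k + 2)) -
          Real.logb 2 (F (k + 1)) / 2 ^ (k + 1)) := by
      congr 1
      funext k
      rw [one_div, inv_pow, inv_pow, pow_succ, pow_succ, pow_succ]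
      field_simp
      ring
    rw [h1, (hS'.mul_left 2).tsum_sub hS, tsum_mul_left, h0]
    ring
  rw [e]
  have key : (fun n : ℕ => Real.logb 2 (NWords n XX) / n) = fun n : ℕ =>
      ∑' k : ℕ, (Real.logb 2 (F (k + 2)) - Real.logb 2 (F (k + 1))) *
        (((n / 2 ^ k : ℕ) : ℝ) / n - ((n / 2 ^ (k + 1) : ℕ) : ℝ) / n) := by
    funext n
    rw [NWords_eq, ← ((hasSum_log F hF1 hF2 hFrec n).div_const (n : ℝ)).tsum_eq]
    congr 1
    funext k
    ring
  rw [key]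
  apply tendsto_tsum_of_dominated_convergence (bound := fun k : ℕ => (1 / 2 : ℝ) ^ k)
  · exact summable_geometric_of_lt_one (by norm_num) (by norm_num)
  · intro k
    exact ((tendsto_div k).sub (tendsto_div (k + 1))).const_mul _
  · filter_upwards [eventually_gt_atTop 0] with n hn k
    obtain ⟨-, -, h0, h1⟩ := L_bounds F hF1 hF2 hFrec k
    have hn' : (0 : ℝ) < n := by exact_mod_cast hn
    have a1 : ((n / 2 ^ k : ℕ) : ℝ) / n ≤ (1 / 2) ^ k := by
      rw [div_le_iff₀ hn']
      have := @Nat.cast_div_le ℝ _ _ _ n (2 ^ k)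
      push_cast at this
      rw [one_div, inv_pow]
      calc _ ≤ _ := this
        _ = _ := by field_simp
    have a2 : (0 : ℝ) ≤ ((n / 2 ^ (k + 1) : ℕ) : ℝ) / n := by positivity
    have a3 : ((n / 2 ^ (k + 1) : ℕ) : ℝ) / n ≤ ((n / 2 ^ k : ℕ) : ℝ) / n := by
      apply div_le_div_of_nonneg_right _ hn'.le
      exact_mod_cast Nat.div_le_div_left (Nat.pow_le_pow_right (by norm_num) (by omega))
        (by positivity)
    rw [Real.norm_eq_abs, abs_of_nonneg (mul_nonneg h0 (by linarith))]
    calc _ ≤ 1 * (((n / 2 ^ k : ℕ) : ℝ) / n - ((n / 2 ^ (k + 1) : ℕ) : ℝ) / n) :=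
          mul_le_mul_of_nonneg_right h1 (by linarith)
      _ ≤ _ := by linarith

end Mink

/-! ### Upper bound for the Hausdorff dimension -/

def cc : ℝ := 377 / 500

lemma cc_pos : 0 < cc := by norm_num [cc]
lemma cc_lt : cc < 1 := by norm_num [cc]
lemma cc_sum : cc ^ 2 + cc ^ 3 ≤ 1 := by norm_num [cc]

def gg (S : Finset ℕ) (j : ℕ) : ℝ :=
  if j ∈ S then (if 2 ∣ j ∧ j / 2 ∈ S then 0 else cc ^ 3)
  else (if 2 ∣ j ∧ j / 2 ∈ S then 1 else cc ^ 2)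

def WW (n : ℕ) (S : Finset ℕ) : ℝ := ∏ j ∈ Finset.Icc 1 n, gg S j

lemma gg_nonneg (S : Finset ℕ) (j : ℕ) : 0 ≤ gg S j := by
  have := cc_pos
  unfold gg
  split_ifs <;> positivity

lemma WW_nonneg (n : ℕ) (S : Finset ℕ) : 0 ≤ WW n S :=
  Finset.prod_nonneg (fun _ _ => gg_nonneg _ _)

lemma Icc_succ (n : ℕ) : Finset.Icc 1 (n + 1) = insert (n + 1) (Finset.Icc 1 n) := by
  ext a; simp; omega

lemma WW_succ (n : ℕ) (S : Finset ℕ) : WW (n + 1) S = gg S (n + 1) * WW n S := by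
  unfold WW
  rw [Icc_succ, Finset.prod_insert (by simp)]

lemma WW_insert (n : ℕ) (S : Finset ℕ) : WW n (insert (n + 1) S) = WW n S := by
  unfold WW
  apply Finset.prod_congr rfl
  intro j hj
  rw [Finset.mem_Icc] at hj
  unfold gg
  have h1 : j ≠ n + 1 := by omega
  have h2 : j / 2 ≠ n + 1 := by omega
  simp only [Finset.mem_insert, h1, h2, false_or]

lemma gg_add (n : ℕ) (S : Finset ℕ) (hS : S ⊆ Finset.Icc 1 n) :
    gg S (n + 1) + gg (insert (n + 1) S) (n + 1) ≤ 1 := by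
  have h1 : n + 1 ∉ S := by
    intro h
    have := Finset.mem_Icc.1 (hS h)
    omega
  have h2 : (n + 1) / 2 ≠ n + 1 := by omega
  unfold gg
  simp only [Finset.mem_insert, h1, h2, false_or, true_or, if_true, if_false]
  have := cc_sum
  split_ifs <;> linarith

lemma sum_WW (n : ℕ) : ∑ S ∈ (Finset.Icc 1 n).powerset, WW n S ≤ 1 := by
  induction n with
  | zero => simp [WW]
  | succ n ih =>
    rw [Icc_succ, Finset.sum_powerset_insert (by simp), ← Finset.sum_add_distrib]
    refine le_trans (Finset.sum_le_sum ?_) ih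
    intro S hS
    rw [Finset.mem_powerset] at hS
    rw [WW_succ, WW_succ, WW_insert, ← add_mul]
    exact mul_le_of_le_one_left (WW_nonneg _ _) (gg_add n S hS)

def NN (n : ℕ) (S : Finset ℕ) : ℕ := ((Finset.Icc 1 n).filter (· ∈ S)).card

lemma NN_succ (n : ℕ) (S : Finset ℕ) :
    NN (n + 1) S = NN n S + if n + 1 ∈ S then 1 else 0 := by
  unfold NN
  rw [Icc_succ, Finset.filter_insert]
  split_ifs
  · rw [Finset.card_insert_of_notMem (by simp)]
  · rfl

lemma WW_eq (S : Finset ℕ) (hS : legal S) (n : ℕ) :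
    WW n S * cc ^ (2 * NN (n / 2) S) = cc ^ (2 * n + NN n S) := by
  induction n with
  | zero => simp [WW, NN]
  | succ n ih =>
    have hN2 : NN ((n + 1) / 2) S =
        NN (n / 2) S + if 2 ∣ n + 1 ∧ (n + 1) / 2 ∈ S then 1 else 0 := by
      by_cases h : 2 ∣ n + 1
      · have : (n + 1) / 2 = n / 2 + 1 := by omega
        rw [this, NN_succ]
        simp [h]
      · have : (n + 1) / 2 = n / 2 := by omega
        rw [this]
        simp [h]
    rw [hN2, NN_succ, WW_succ]
    unfold gg
    by_cases h1 : n + 1 ∈ S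
    · have h2 : ¬ (2 ∣ n + 1 ∧ (n + 1) / 2 ∈ S) := by
        rintro ⟨h, h'⟩
        apply hS _ h'
        rwa [Nat.mul_div_cancel' h]
      simp only [h1, h2, if_true, if_false]
      calc _ = cc ^ 3 * (WW n S * cc ^ (2 * NN (n / 2) S)) := by ring_nf
        _ = _ := by rw [ih]; ring
    · by_cases h2 : (2 ∣ n + 1 ∧ (n + 1) / 2 ∈ S)
      · simp only [h1, h2, if_true, if_false, and_self]
        calc _ = cc ^ 2 * (WW n S * cc ^ (2 * NN (n / 2) S)) := by ring
          _ = _ := by rw [ih]; ring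
      · simp only [h1, h2, if_true, if_false]
        calc _ = cc ^ 2 * (WW n S * cc ^ (2 * NN (n / 2) S)) := by ring_nf
          _ = _ := by rw [ih]; ring

lemma NN_pre (m n : ℕ) (h : m ≤ n) (x : ℕ+ → Fin 2) : NN m (pre n x) = (pre m x).card := by
  unfold NN
  congr 1
  ext k
  simp only [Finset.mem_filter, Finset.mem_Icc, mem_pre]
  constructor
  · rintro ⟨h1, h2, h3⟩; exact ⟨h1.2, h3⟩
  · rintro ⟨h1, h2, h3⟩; exact ⟨⟨h2, h1⟩, by omega, h2, h3⟩

lemma io_lemma (a : ℕ → ℝ) (h0 : ∀ l, 0 ≤ a l) (h1 : ∀ l, a l ≤ 1) (δ : ℝ) (hδ : 0 < δ) (L : ℕ) :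
    ∃ l, L ≤ l ∧ a (l + 1) ≤ a l + δ := by
  by_contra hcon
  push Not at hcon
  have key : ∀ k : ℕ, k * δ ≤ a (L + k) := by
    intro k
    induction k with
    | zero => simpa using h0 L
    | succ k ih =>
      have := hcon (L + k) (by omega)
      push_cast
      rw [← add_assoc]
      linarith
  obtain ⟨k, hk⟩ := exists_nat_gt (1 / δ)
  rw [div_lt_iff₀ hδ] at hk
  have := key k
  have := h1 (L + k)
  linarith

lemma good_io (x : ℕ+ → Fin 2) (hx : x ∈ XX) (ρ : ℝ) (h0 : 0 < ρ) (h1 : ρ < cc ^ 2) (L : ℕ) :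
    ∃ n, L ≤ n ∧ ρ ^ n ≤ WW n (pre n x) := by
  have cpos := cc_pos
  have clt := cc_lt
  set δ : ℝ := Real.logb cc (ρ / cc ^ 2) with hδdef
  have hδ : 0 < δ := by
    apply Real.logb_pos_of_base_lt_one cpos clt (by positivity)
    rw [div_lt_one (by positivity)]
    exact h1
  have hρ : cc ^ 2 * cc ^ δ = ρ := by
    rw [hδdef, Real.rpow_logb cpos clt.ne (by positivity)]
    field_simp
  obtain ⟨l, hl, hal⟩ := io_lemma (fun l => ((pre (2 ^ l) x).card : ℝ) / 2 ^ l)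
    (fun l => by positivity)
    (fun l => by
      rw [div_le_one (by positivity)]
      have : (pre (2 ^ l) x).card ≤ 2 ^ l := by
        calc _ ≤ (Finset.Icc 1 (2 ^ l)).card := Finset.card_filter_le _ _
          _ = _ := by simp
      exact_mod_cast this) δ hδ L
  refine ⟨2 ^ (l + 1), ?_, ?_⟩
  · have := Nat.lt_two_pow_self (n := l + 1)
    omega
  · have hW := WW_eq _ (pre_legal (2 ^ (l + 1)) x hx) (2 ^ (l + 1))
    have hd : 2 ^ (l + 1) / 2 = 2 ^ l := by rw [pow_succ]; simp
    rw [hd, NN_pre _ _ le_rfl, NN_pre _ _ (Nat.pow_le_pow_right (by norm_num) (by omega))] at hW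
    have hcard : ((pre (2 ^ (l + 1)) x).card : ℝ) ≤
        2 * (pre (2 ^ l) x).card + δ * (2 ^ (l + 1) : ℕ) := by
      have h2 : (0 : ℝ) < 2 ^ l := by positivity
      push_cast
      rw [div_le_iff₀ (by positivity)] at hal
      have : (((pre (2 ^ l) x).card : ℝ) / 2 ^ l + δ) * 2 ^ (l + 1) =
        2 * (pre (2 ^ l) x).card + δ * 2 ^ (l + 1) := by
        rw [pow_succ]; field_simp
      linarith
    generalize 2 ^ (l + 1) = n at *
    generalize (pre (2 ^ l) x).card = A at *
    generalize (pre n x).card = B at *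
    have e1 : cc ^ (2 * A) * (cc ^ δ) ^ n ≤ cc ^ B := by
      rw [← Real.rpow_natCast (cc ^ δ) n, ← Real.rpow_mul cpos.le, ← Real.rpow_natCast cc (2 * A),
        ← Real.rpow_add cpos, ← Real.rpow_natCast cc B]
      apply Real.rpow_le_rpow_of_exponent_ge cpos clt.le
      push_cast
      exact hcard
    have pA : 0 < cc ^ (2 * A) := by positivity
    rw [← mul_le_mul_iff_left₀ pA, hW, ← hρ, mul_pow, pow_add, ← pow_mul, mul_assoc]
    apply mul_le_mul_of_nonneg_left _ (by positivity)
    linarith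

def Good (ρ : ℝ) (n : ℕ) : Finset (Finset ℕ) :=
  (Finset.Icc 1 n).powerset.filter (fun S => ρ ^ n ≤ WW n S)

lemma card_Good (ρ : ℝ) (n : ℕ) : (Good ρ n).card * ρ ^ n ≤ 1 := by
  calc (Good ρ n).card * ρ ^ n = ∑ S ∈ Good ρ n, ρ ^ n := by simp
    _ ≤ ∑ S ∈ Good ρ n, WW n S := Finset.sum_le_sum (fun S hS => (Finset.mem_filter.1 hS).2)
    _ ≤ ∑ S ∈ (Finset.Icc 1 n).powerset, WW n S :=
      Finset.sum_le_sum_of_subset_of_nonneg (Finset.filter_subset _ _) (fun _ _ _ => WW_nonneg _ _)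
    _ ≤ 1 := sum_WW n

lemma val_summable (x : ℕ+ → Fin 2) :
    Summable (fun k : ℕ+ => ((x k : ℕ) : ℝ) * ((2 : ℕ) : ℝ)⁻¹ ^ (k : ℕ)) := by
  have h : Summable (fun k : ℕ+ => ((2 : ℕ) : ℝ)⁻¹ ^ (k : ℕ)) :=
    (summable_geometric_of_lt_one (r := ((2 : ℕ) : ℝ)⁻¹) (by norm_num) (by norm_num)).comp_injective
      PNat.coe_injective
  refine Summable.of_nonneg_of_le (fun k => by positivity) (fun k => ?_) h
  apply mul_le_of_le_one_left (by positivity)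
  have := (x k).2
  exact_mod_cast (by omega : (x k : ℕ) ≤ 1)

lemma val_close (n : ℕ) (x y : ℕ+ → Fin 2) (h : pre n x = pre n y) :
    ValMap 2 x - ValMap 2 y ≤ (1 / 2) ^ n := by
  unfold ValMap
  rw [← (val_summable x).tsum_sub (val_summable y)]
  set b : ℕ → ℝ := fun k => if k ≤ n then 0 else (1 / 2 : ℝ) ^ k with hb
  have hgeo : Summable (fun k : ℕ => (1 / 2 : ℝ) ^ k) :=
    summable_geometric_of_lt_one (by norm_num) (by norm_num)
  have hbs : Summable b := by
    refine Summable.of_nonneg_of_le (fun k => ?_) (fun k => ?_) hgeo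
    · simp only [hb]; split_ifs <;> positivity
    · simp only [hb]; split_ifs
      · positivity
      · exact le_rfl
  have hbt : ∑' k : ℕ+, b k = (1 / 2) ^ n := by
    rw [tsum_pnat_eq_tsum_succ (f := b)]
    have hbs1 : Summable (fun k => b (k + 1)) := (summable_nat_add_iff 1).2 hbs
    rw [← hbs1.sum_add_tsum_nat_add n]
    have z : ∑ i ∈ Finset.range n, b (i + 1) = 0 := by
      apply Finset.sum_eq_zero
      intro i hi
      rw [Finset.mem_range] at hi
      simp only [hb]
      rw [if_pos (by omega)]
    have e : ∀ i, b (i + n + 1) = (1 / 2) ^ (n + 1) * (1 / 2) ^ i := by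
      intro i
      simp only [hb]
      rw [if_neg (by omega)]
      ring
    rw [z, zero_add]
    simp only [e]
    rw [tsum_mul_left, tsum_geometric_of_lt_one (by norm_num) (by norm_num), pow_succ]
    norm_num
    ring
  rw [← hbt]
  refine Summable.tsum_le_tsum ?_ ((val_summable x).sub (val_summable y))
    (hbs.comp_injective PNat.coe_injective)
  intro k
  simp only [hb]
  have hx := (x k).2
  have hy := (y k).2
  split_ifs with hk
  · have hxy : x k = 1 ↔ y k = 1 := by
      have := Finset.ext_iff.1 h k
      rw [mem_pre, mem_pre] at this
      have kp : 0 < (k : ℕ) := k.2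
      constructor
      · intro hx
        obtain ⟨_, _, h'⟩ := this.1 ⟨hk, kp, hx⟩
        exact h'
      · intro hx
        obtain ⟨_, _, h'⟩ := this.2 ⟨hk, kp, hx⟩
        exact h'
    have : x k = y k := by
      generalize x k = a at *
      generalize y k = b at *
      clear hx hy
      revert hxy; revert a b; decide
    rw [this]; simp
  · have h1 : ((x k : ℕ) : ℝ) ≤ 1 := by exact_mod_cast (by omega : (x k : ℕ) ≤ 1)
    have h2 : (0 : ℝ) ≤ ((y k : ℕ) : ℝ) := by positivity
    push_cast
    rw [one_div, ← sub_mul]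
    exact mul_le_of_le_one_left (by positivity) (by linarith)

def TT (n : ℕ) (S : Finset ℕ) : Set ℝ := {r | ∃ x ∈ XX, pre n x = S ∧ r = ValMap 2 x}

lemma diam_TT (n : ℕ) (S : Finset ℕ) : Metric.ediam (TT n S) ≤ ENNReal.ofReal ((1 / 2) ^ n) := by
  apply Metric.ediam_le
  rintro _ ⟨x, -, hx, rfl⟩ _ ⟨y, -, hy, rfl⟩
  rw [edist_dist, Real.dist_eq]
  apply ENNReal.ofReal_le_ofReal
  rw [abs_sub_le_iff]
  exact ⟨val_close n x y (hx.trans hy.symm), val_close n y x (hy.trans hx.symm)⟩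

lemma haus (d : NNReal) (hd : (2 : ℝ) ^ (-(d : ℝ)) < cc ^ 2) : dimH (XiSet XX) ≤ d := by
  obtain ⟨ρ, hρ1, hρ2⟩ := exists_between hd
  have hpos : (0 : ℝ) < 2 ^ (-(d : ℝ)) := by positivity
  have hρ : 0 < ρ := hpos.trans hρ1
  set q : ℝ := 2 ^ (-(d : ℝ)) / ρ with hq
  have hq0 : 0 < q := by positivity
  have hq1 : q < 1 := by rw [hq, div_lt_one hρ]; exact hρ1
  apply dimH_le_of_hausdorffMeasure_ne_top
  have hsum : ∑' n : ℕ, ENNReal.ofReal q ^ n ≠ ∞ := by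
    rw [ENNReal.tsum_geometric]
    apply ENNReal.inv_ne_top.2
    rw [Ne, tsub_eq_zero_iff_le, not_le]
    exact ENNReal.ofReal_lt_one.2 hq1
  have hlim := ENNReal.tendsto_sum_nat_add (fun n => ENNReal.ofReal q ^ n) hsum
  have hle := Measure.hausdorffMeasure_le_liminf_tsum (X := ℝ) (β := ℕ)
    (ι := fun L => Σ k : ℕ, {S // S ∈ Good ρ (k + L)}) (d : ℝ) (XiSet XX) (l := atTop)
    (fun L => ENNReal.ofReal ((1 / 2) ^ L))
    (by
      rw [← ENNReal.ofReal_zero]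
      apply ENNReal.tendsto_ofReal
      exact tendsto_pow_atTop_nhds_zero_of_lt_one (by norm_num) (by norm_num))
    (fun L p => TT (p.1 + L) p.2.1)
    (Eventually.of_forall (by
      rintro L ⟨k, S⟩
      refine (diam_TT _ _).trans (ENNReal.ofReal_le_ofReal ?_)
      exact pow_le_pow_of_le_one (by norm_num) (by norm_num) (by simp)))
    (Eventually.of_forall (by
      rintro L r ⟨x, hx, rfl⟩
      obtain ⟨n, hn, hg⟩ := good_io x hx ρ hρ hρ2 L
      obtain ⟨k, rfl⟩ := Nat.exists_eq_add_of_le' hn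
      rw [Set.mem_iUnion]
      refine ⟨⟨k, pre (k + L) x, ?_⟩, x, hx, rfl, rfl⟩
      rw [Good, Finset.mem_filter, Finset.mem_powerset]
      exact ⟨Finset.filter_subset _ _, hg⟩))
  have hz : μH[(d : ℝ)] (XiSet XX) ≤ 0 := by
    refine hle.trans ?_
    rw [← hlim.liminf_eq]
    refine liminf_le_liminf (Eventually.of_forall (fun L => ?_))
    rw [ENNReal.tsum_sigma']
    apply ENNReal.tsum_le_tsum
    intro k
    simp only
    generalize k + L = n
    calc ∑' S : {S // S ∈ Good ρ n}, Metric.ediam (TT n S.1) ^ (d : ℝ)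
        ≤ ∑' S : {S // S ∈ Good ρ n}, ENNReal.ofReal ((1 / 2) ^ n) ^ (d : ℝ) := by
          apply ENNReal.tsum_le_tsum
          intro S
          exact ENNReal.rpow_le_rpow (diam_TT _ _) d.coe_nonneg
      _ = ((Good ρ n).card : ℝ≥0∞) * ENNReal.ofReal ((1 / 2) ^ n) ^ (d : ℝ) := by
          rw [tsum_fintype]; simp
      _ ≤ ENNReal.ofReal q ^ n := by
          rw [ENNReal.ofReal_rpow_of_nonneg (by positivity) d.coe_nonneg, ← ENNReal.ofReal_natCast,
            ← ENNReal.ofReal_mul (by positivity), ← ENNReal.ofReal_pow hq0.le]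
          apply ENNReal.ofReal_le_ofReal
          have e : ((1 / 2 : ℝ) ^ n) ^ (d : ℝ) = (2 ^ (-(d : ℝ))) ^ n := by
            rw [← Real.rpow_natCast (1 / 2 : ℝ) n, ← Real.rpow_mul (by norm_num), mul_comm,
              Real.rpow_mul (by norm_num), Real.rpow_natCast, one_div,
              Real.inv_rpow (by norm_num), Real.rpow_neg (by norm_num)]
          rw [e, hq, div_pow, le_div_iff₀ (by positivity)]
          have := card_Good ρ n
          have p : (0 : ℝ) < (2 ^ (-(d : ℝ))) ^ n := by positivity
          calc _ = ((Good ρ n).card * ρ ^ n) * (2 ^ (-(d : ℝ))) ^ n := by ring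
            _ ≤ 1 * (2 ^ (-(d : ℝ))) ^ n := mul_le_mul_of_nonneg_right this p.le
            _ = _ := one_mul _
  exact ne_top_of_le_ne_top ENNReal.zero_ne_top hz

set_option exponentiation.threshold 5000 in
lemma numeric : ((500 : ℝ) / 377) ^ 2048 <
    2 ^ 256 * 3 ^ 128 * 5 ^ 64 * 8 ^ 32 * 13 ^ 16 * 21 ^ 8 * 34 ^ 4 * 55 ^ 2 * 89 := by
  rw [div_pow, div_lt_iff₀ (by positivity)]
  norm_num

lemma strict (F : ℕ → ℕ) (hF1 : F 1 = 1) (hF2 : F 2 = 2)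
    (hFrec : ∀ k, 1 ≤ k → F (k + 2) = F (k + 1) + F k) :
    dimH (XiSet XX) < ENNReal.ofReal (∑' k : ℕ, Real.logb 2 (F (k + 2)) / 2 ^ (k + 2)) := by
  have hS' : Summable (fun k : ℕ => Real.logb 2 (F (k + 2)) / 2 ^ (k + 2)) :=
    (summable_nat_add_iff 1).2 (summable_L F hF1 hF2 hFrec)
  have nn : ∀ k : ℕ, 0 ≤ Real.logb 2 (F (k + 2)) / 2 ^ (k + 2) := by
    intro k
    have := (L_bounds F hF1 hF2 hFrec (k + 1)).1
    positivity
  have hle := hS'.sum_le_tsum (Finset.range 10) (fun k _ => nn k)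
  rw [Finset.sum_range_succ] at hle
  have f3 : F 3 = 3 := by rw [hFrec 1 (by norm_num)]; simp [hF1, hF2]
  have f4 : F 4 = 5 := by rw [hFrec 2 (by norm_num)]; simp [hF2, f3]
  have f5 : F 5 = 8 := by rw [hFrec 3 (by norm_num)]; simp [f4, f3]
  have f6 : F 6 = 13 := by rw [hFrec 4 (by norm_num)]; simp [f4, f5]
  have f7 : F 7 = 21 := by rw [hFrec 5 (by norm_num)]; simp [f6, f5]
  have f8 : F 8 = 34 := by rw [hFrec 6 (by norm_num)]; simp [f6, f7]
  have f9 : F 9 = 55 := by rw [hFrec 7 (by norm_num)]; simp [f8, f7]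
  have f10 : F 10 = 89 := by rw [hFrec 8 (by norm_num)]; simp [f8, f9]
  have f11 : F 11 = 144 := by rw [hFrec 9 (by norm_num)]; simp [f10, f9]
  set d : ℝ := ∑ k ∈ Finset.range 9, Real.logb 2 (F (k + 2)) / 2 ^ (k + 2) with hd
  have hd0 : 0 ≤ d := Finset.sum_nonneg (fun k _ => nn k)
  have hlast : 0 < Real.logb 2 (F (9 + 2)) / 2 ^ (9 + 2) := by
    norm_num [f11]
    exact Real.logb_pos (by norm_num) (by norm_num)
  have hlt : d < ∑' k : ℕ, Real.logb 2 (F (k + 2)) / 2 ^ (k + 2) := by linarith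
  have hbig : (2 : ℝ) ^ (-d) < cc ^ 2 := by
    have h1024 : 1024 * d = Real.logb 2 (2 ^ 256 * 3 ^ 128 * 5 ^ 64 * 8 ^ 32 * 13 ^ 16 * 21 ^ 8 *
        34 ^ 4 * 55 ^ 2 * 89) := by
      rw [Real.logb_mul (by positivity) (by positivity), Real.logb_mul (by positivity) (by positivity),
        Real.logb_mul (by positivity) (by positivity), Real.logb_mul (by positivity) (by positivity),
        Real.logb_mul (by positivity) (by positivity), Real.logb_mul (by positivity) (by positivity),
        Real.logb_mul (by positivity) (by positivity), Real.logb_mul (by positivity) (by positivity)]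
      simp only [Real.logb_pow]
      rw [hd]
      simp only [Finset.sum_range_succ, Finset.sum_range_zero, Nat.reduceAdd, hF2, f3, f4, f5, f6, f7,
        f8, f9, f10, zero_add]
      push_cast
      ring
    have hlog := Real.logb_lt_logb (b := 2) (by norm_num) (by positivity) numeric
    rw [← h1024, Real.logb_pow] at hlog
    have hc : Real.logb 2 cc = - Real.logb 2 (500 / 377) := by
      rw [← Real.logb_inv]
      congr 1
      norm_num [cc]
    have : (cc ^ 2 : ℝ) = 2 ^ (Real.logb 2 (cc ^ 2)) := by
      rw [Real.rpow_logb (by norm_num) (by norm_num)]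
      have := cc_pos
      positivity
    rw [this]
    apply Real.rpow_lt_rpow_of_exponent_lt (by norm_num)
    rw [Real.logb_pow, hc]
    push_cast at hlog ⊢
    linarith
  have hH := haus d.toNNReal (by rwa [Real.coe_toNNReal _ hd0])
  refine hH.trans_lt ?_
  exact (ENNReal.ofReal_lt_ofReal_iff (hd0.trans_lt hlt)).2 hlt

end GM

/-- **(1.4) and Proposition 1.1.** The Minkowski dimension of the multiplicative golden mean
shift exists and equals `Σ_{k≥1} log₂ F_{k+1}/2^{k+1}`, and the Hausdorff dimension of `Ξ_g`
is strictly smaller. -/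
theorem stmt5 (F : ℕ → ℕ) (hF1 : F 1 = 1) (hF2 : F 2 = 2)
    (hFrec : ∀ k, 1 ≤ k → F (k + 2) = F (k + 1) + F k) :
    Tendsto
      (fun n : ℕ =>
        Real.logb 2
          (NWords n {x : ℕ+ → Fin 2 | ∀ k : ℕ+, (x k : ℕ) * (x (2 * k) : ℕ) = 0}) / n)
      atTop (𝓝 (∑' k : ℕ, Real.logb 2 (F (k + 2)) / 2 ^ (k + 2))) ∧
    dimH (XiSet {x : ℕ+ → Fin 2 | ∀ k : ℕ+, (x k : ℕ) * (x (2 * k) : ℕ) = 0}) <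
      ENNReal.ofReal (∑' k : ℕ, Real.logb 2 (F (k + 2)) / 2 ^ (k + 2)) := by
  exact ⟨GM.mink F hF1 hF2 hFrec, GM.strict F hF1 hF2 hFrec⟩
end
end

section
/- Let m ≥ 2, let q ≥ 2 be an integer, and let Ω be a nonempty closed subset of Σ_m. Let t be the unique function on the vertices of the tree of prefixes Γ(Ω), taking values in [1, m^{1/(q-1)}], satisfying t(u)^q = Σ_{j : uj ∈ Pref(Ω)} t(uj) for every prefix u (where the sum at the root ∅ is over the one-letter prefixes). Then the Hausdorff dimension of Ξ_Ω equals (q-1) · log_m t(∅). -/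
open scoped Classical ENNReal
open Filter MeasureTheory Topology

noncomputable section

/-! ### Words along geometric progressions -/

/-- the word read along the progression through `k`, up to position `k`. -/
def wd {m : ℕ} (q : ℕ) (y : ℕ → Fin m) (k : ℕ) : List (Fin m) :=
  if h : 2 ≤ q ∧ 0 < k ∧ q ∣ k then wd q y (k / q) ++ [y k] else [y k]
termination_by k
decreasing_by exact Nat.div_lt_self h.2.1 h.1

/-- the word read along the progression strictly before position `k`. -/
def preW {m : ℕ} (q : ℕ) (y : ℕ → Fin m) (k : ℕ) : List (Fin m) :=
  if q ∣ k then wd q y (k / q) else []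

theorem wd_eq {m q : ℕ} (hq : 2 ≤ q) (y : ℕ → Fin m) {k : ℕ} (hk : 0 < k) :
    wd q y k = preW q y k ++ [y k] := by
  rw [wd, preW]
  by_cases h : q ∣ k <;> simp [h, hq, hk]

/-- the first element of the progression through `k`. -/
def rootQ (q : ℕ) (k : ℕ) : ℕ :=
  if h : 2 ≤ q ∧ 0 < k ∧ q ∣ k then rootQ q (k / q) else k
termination_by k
decreasing_by exact Nat.div_lt_self h.2.1 h.1

theorem rootQ_dvd {q : ℕ} (hq : 2 ≤ q) {k : ℕ} (hk : 0 < k) (h : q ∣ k) :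
    rootQ q k = rootQ q (k / q) := by
  rw [rootQ]; simp [hq, hk, h]

theorem rootQ_not_dvd {q : ℕ} {k : ℕ} (h : ¬ q ∣ k) :
    rootQ q k = k := by
  rw [rootQ]; simp [h]

theorem root_mul {m q : ℕ} (hq : 2 ≤ q) (y : ℕ → Fin m) (k : ℕ) (hk : 0 < k) :
    rootQ q k * q ^ (preW q y k).length = k := by
  induction k using Nat.strong_induction_on with
  | _ k ih =>
    by_cases h : q ∣ k
    · have h1 : 0 < k / q := Nat.div_pos (Nat.le_of_dvd hk h) (by omega)
      have h2 := ih (k / q) (Nat.div_lt_self hk hq) h1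
      rw [rootQ_dvd hq hk h]
      have : (preW q y k).length = (preW q y (k/q)).length + 1 := by
        conv_lhs => rw [preW]
        rw [if_pos h, wd_eq hq y h1]; simp
      rw [this, pow_succ, ← mul_assoc, h2]
      exact Nat.div_mul_cancel h
    · rw [rootQ_not_dvd h, preW]; simp [h]

theorem wd_congr {m q : ℕ} (hq : 2 ≤ q) (y z : ℕ → Fin m) (n : ℕ)
    (h : ∀ k, 0 < k → k ≤ n → y k = z k) : ∀ k, 0 < k → k ≤ n → wd q y k = wd q z k := by
  intro k
  induction k using Nat.strong_induction_on with
  | _ k ih =>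
    intro hk hkn
    rw [wd_eq hq y hk, wd_eq hq z hk, h k hk hkn]
    congr 1
    unfold preW
    split_ifs with hd
    · have h1 : 0 < k / q := Nat.div_pos (Nat.le_of_dvd hk hd) (by omega)
      exact ih _ (Nat.div_lt_self hk hq) h1 ((Nat.div_le_self _ _).trans hkn)
    · rfl

theorem preW_congr {m q : ℕ} (hq : 2 ≤ q) (y z : ℕ → Fin m) (n : ℕ)
    (h : ∀ k, 0 < k → k ≤ n → y k = z k) (k : ℕ) (hk : 0 < k) (hkn : k ≤ n + 1) :
    preW q y k = preW q z k := by
  unfold preW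
  split_ifs with hd
  · have h1 : 0 < k / q := Nat.div_pos (Nat.le_of_dvd hk hd) (by omega)
    have h2 := Nat.div_lt_self hk hq
    exact wd_congr hq y z n h _ h1 (by omega)
  · rfl

/-- random word driven by the choices `ω`. -/
def rwd {m : ℕ} (q : ℕ) (ω : ℕ → List (Fin m) → Fin m) (k : ℕ) : List (Fin m) :=
  if h : 2 ≤ q ∧ 0 < k ∧ q ∣ k then
    rwd q ω (k / q) ++ [ω (rootQ q k) (rwd q ω (k / q))] else [ω (rootQ q k) []]
termination_by k
decreasing_by all_goals exact Nat.div_lt_self h.2.1 h.1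

/-- random sequence driven by the choices `ω`. -/
def xw {m : ℕ} (q : ℕ) (ω : ℕ → List (Fin m) → Fin m) (k : ℕ) : Fin m :=
  ω (rootQ q k) (if q ∣ k then rwd q ω (k / q) else [])

theorem wd_xw {m q : ℕ} (hq : 2 ≤ q) (ω : ℕ → List (Fin m) → Fin m) (k : ℕ) (hk : 0 < k) :
    wd q (xw q ω) k = rwd q ω k := by
  induction k using Nat.strong_induction_on with
  | _ k ih =>
    rw [wd_eq hq _ hk, rwd, preW, xw]
    by_cases hd : q ∣ k
    · have h1 : 0 < k / q := Nat.div_pos (Nat.le_of_dvd hk hd) (by omega)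
      simp [hd, hq, hk, ih _ (Nat.div_lt_self hk hq) h1]
    · simp [hd]

theorem xw_eq {m q : ℕ} (hq : 2 ≤ q) (ω : ℕ → List (Fin m) → Fin m) (k : ℕ) (hk : 0 < k) :
    xw q ω k = ω (rootQ q k) (preW q (xw q ω) k) := by
  rw [preW]
  conv_lhs => rw [xw]
  by_cases hd : q ∣ k
  · have h1 : 0 < k / q := Nat.div_pos (Nat.le_of_dvd hk hd) (by omega)
    simp only [hd, if_true, wd_xw hq ω _ h1]
  · simp [hd]

theorem xw_cyl {m q : ℕ} (hq : 2 ≤ q) (ω : ℕ → List (Fin m) → Fin m) (y : ℕ → Fin m) (n : ℕ) :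
    (∀ k, 0 < k → k ≤ n → xw q ω k = y k) ↔
      ∀ k, 0 < k → k ≤ n → ω (rootQ q k) (preW q y k) = y k := by
  constructor
  · intro h k hk hkn
    rw [← preW_congr hq _ _ n h k hk (by omega), ← xw_eq hq ω k hk, h k hk hkn]
  · intro h
    intro k
    induction k using Nat.strong_induction_on with
    | _ k ih =>
      intro hk hkn
      rw [xw_eq hq ω k hk, preW_congr hq (xw q ω) y (k-1)
        (fun j hj hjk => ih j (by omega) hj (by omega)) k hk (by omega)]
      exact h k hk hkn

/-- the word of length `l` driven by the choices `c`. -/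
def Wc {m : ℕ} (c : List (Fin m) → Fin m) : ℕ → List (Fin m)
  | 0 => []
  | l + 1 => Wc c l ++ [c (Wc c l)]

theorem rootQ_pow_mul {q : ℕ} (hq : 2 ≤ q) (i : ℕ) (hi : ¬ q ∣ i) (l : ℕ) :
    rootQ q (q ^ l * i) = i := by
  have hi0 : 0 < i := Nat.pos_of_ne_zero (by rintro rfl; simp at hi)
  induction l with
  | zero => simpa using rootQ_not_dvd hi
  | succ l ih =>
    rw [rootQ_dvd hq (by positivity) (by rw [pow_succ', mul_assoc]; exact Dvd.intro _ rfl)]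
    rw [pow_succ', mul_assoc, Nat.mul_div_cancel_left _ (by omega), ih]

theorem rwd_pow_mul {m q : ℕ} (hq : 2 ≤ q) (ω : ℕ → List (Fin m) → Fin m) (i : ℕ)
    (hi : ¬ q ∣ i) (l : ℕ) : rwd q ω (q ^ l * i) = Wc (ω i) (l + 1) := by
  have hi0 : 0 < i := Nat.pos_of_ne_zero (by rintro rfl; simp at hi)
  induction l with
  | zero => rw [rwd]; simp [hi, Wc, rootQ_not_dvd hi]
  | succ l ih =>
    rw [rwd]
    have h1 : q ∣ q ^ (l+1) * i := by rw [pow_succ', mul_assoc]; exact Dvd.intro _ rfl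
    have h2 : 0 < q ^ (l+1) * i := by positivity
    rw [dif_pos ⟨hq, h2, h1⟩, rootQ_pow_mul hq i hi]
    rw [pow_succ', mul_assoc, Nat.mul_div_cancel_left _ (by omega), ih]
    rfl

/-! ### Sums -/

theorem sum_split {q : ℕ} (hq : 2 ≤ q) (F : ℕ → ℝ) (n : ℕ) :
    ∑ k ∈ Finset.Icc 1 n, F k =
      ∑ k ∈ (Finset.Icc 1 n).filter (fun k => ¬ q ∣ k), F k
        + ∑ k ∈ Finset.Icc 1 (n / q), F (q * k) := by
  rw [← Finset.sum_filter_add_sum_filter_not (Finset.Icc 1 n) (fun k => q ∣ k), add_comm]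
  congr 1
  symm
  refine Finset.sum_bij (fun k _ => q * k) ?_ ?_ ?_ ?_
  · intro a ha
    simp only [Finset.mem_Icc, Finset.mem_filter] at ha ⊢
    have := (Nat.le_div_iff_mul_le (by omega : 0 < q)).1 ha.2
    refine ⟨⟨?_, by linarith⟩, Dvd.intro _ rfl⟩
    have : 0 < q * a := by apply Nat.mul_pos <;> omega
    omega
  · intro a _ b _ h
    exact Nat.eq_of_mul_eq_mul_left (by omega) h
  · intro b hb
    simp only [Finset.mem_Icc, Finset.mem_filter] at hb
    obtain ⟨⟨h1, h2⟩, c, rfl⟩ := hb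
    refine ⟨c, ?_, rfl⟩
    simp only [Finset.mem_Icc]
    refine ⟨Nat.pos_of_ne_zero (by rintro rfl; simp at h1), ?_⟩
    rw [Nat.le_div_iff_mul_le (by omega)]; linarith
  · intros; rfl

theorem sum_split_iter {q : ℕ} (hq : 2 ≤ q) (F : ℕ → ℝ) (n L : ℕ) :
    ∑ k ∈ Finset.Icc 1 n, F k =
      ∑ l ∈ Finset.range L,
        ∑ k ∈ (Finset.Icc 1 (n / q ^ l)).filter (fun k => ¬ q ∣ k), F (q ^ l * k)
        + ∑ k ∈ Finset.Icc 1 (n / q ^ L), F (q ^ L * k) := by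
  induction L with
  | zero => simp
  | succ L ih =>
    rw [ih, Finset.sum_range_succ, sum_split hq (fun k => F (q ^ L * k)), Nat.div_div_eq_div_mul,
      ← pow_succ, add_assoc]
    congr 2
    apply Finset.sum_congr rfl
    intro k _
    rw [pow_succ, mul_assoc]

theorem sum_preW {m q : ℕ} (hq : 2 ≤ q) (G : List (Fin m) → ℝ) (y : ℕ → Fin m) (n : ℕ) :
    ∑ k ∈ Finset.Icc 1 n, G (preW q y k) =
      ∑ k ∈ Finset.Icc 1 (n / q), G (wd q y k) + ((n : ℝ) - (n / q : ℕ)) * G [] := by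
  rw [sum_split hq]
  have h1 : ∑ k ∈ (Finset.Icc 1 n).filter (fun k => ¬ q ∣ k), G (preW q y k)
      = ((n : ℝ) - (n / q : ℕ)) * G [] := by
    have h2 := sum_split hq (fun _ => (1 : ℝ)) n
    simp only [Finset.sum_const, Nat.card_Icc, nsmul_eq_mul, mul_one, Nat.add_sub_cancel] at h2
    rw [h2, add_sub_cancel_right, ← nsmul_eq_mul, ← Finset.sum_const]
    apply Finset.sum_congr rfl
    intro k hk
    rw [preW, if_neg (Finset.mem_filter.1 hk).2]
  rw [h1, add_comm]
  congr 1
  apply Finset.sum_congr rfl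
  intro k _
  rw [preW, if_pos (Dvd.intro _ rfl), Nat.mul_div_cancel_left _ (by omega)]

/-! ### The random sequence -/

/-- transition probabilities on the tree of words. -/
structure Wts (m : ℕ) where
  w : List (Fin m) → Fin m → ℝ
  nn : ∀ u j, 0 ≤ w u j
  one : ∀ u, ∑ j, w u j = 1

/-- the transition law at the word `u`. -/
def Wts.nu {m : ℕ} (p : Wts m) (u : List (Fin m)) : Measure (Fin m) :=
  ∑ j, ENNReal.ofReal (p.w u j) • Measure.dirac j

theorem Wts.nu_apply {m : ℕ} (p : Wts m) (u : List (Fin m)) (j : Fin m) :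
    p.nu u {j} = ENNReal.ofReal (p.w u j) := by
  simp only [Wts.nu, Measure.finsetSum_apply, Measure.smul_apply, smul_eq_mul]
  rw [Finset.sum_eq_single j]
  · simp
  · intro b _ hb
    simp [hb]
  · simp

instance {m : ℕ} (p : Wts m) (u : List (Fin m)) : IsProbabilityMeasure (p.nu u) := by
  constructor
  simp only [Wts.nu, Measure.finsetSum_apply, Measure.smul_apply, smul_eq_mul, measure_univ,
    mul_one]
  rw [← ENNReal.ofReal_sum_of_nonneg (fun j _ => p.nn u j), p.one]
  simp

/-- law of the choices along one progression. -/
def Wts.PL {m : ℕ} (p : Wts m) : Measure (List (Fin m) → Fin m) :=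
  Measure.infinitePi fun u => p.nu u

instance {m : ℕ} (p : Wts m) : IsProbabilityMeasure p.PL := by
  unfold Wts.PL; infer_instance

/-- law of all choices. -/
def Wts.PP {m : ℕ} (p : Wts m) : Measure (ℕ → List (Fin m) → Fin m) :=
  Measure.infinitePi fun _ => p.PL

instance {m : ℕ} (p : Wts m) : IsProbabilityMeasure p.PP := by
  unfold Wts.PP; infer_instance

theorem cyl_prob {m q : ℕ} (hq : 2 ≤ q) (p : Wts m) (y : ℕ → Fin m) (n : ℕ) :
    p.PP {ω | ∀ k, 0 < k → k ≤ n → xw q ω k = y k} =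
      ENNReal.ofReal (∏ k ∈ Finset.Icc 1 n, p.w (preW q y k) (y k)) := by
  have hset : {ω : ℕ → List (Fin m) → Fin m | ∀ k, 0 < k → k ≤ n → xw q ω k = y k} =
      (MeasurableEquiv.curry ℕ (List (Fin m)) (Fin m)).symm ⁻¹'
        (Set.pi ((Finset.Icc 1 n).image (fun k => (rootQ q k, preW q y k)) :
          Finset (ℕ × List (Fin m)))
          (fun a => {y (a.1 * q ^ a.2.length)})) := by
    ext ω
    simp only [Set.mem_ofPred_eq, xw_cyl hq, Set.mem_preimage, Set.mem_pi, Finset.coe_image,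
      Set.mem_image, Finset.coe_Icc, Set.mem_Icc, Set.mem_singleton_iff]
    constructor
    · rintro h _ ⟨k, ⟨hk1, hk2⟩, rfl⟩
      simp only [root_mul hq y k hk1]
      exact h k hk1 hk2
    · intro h k hk1 hk2
      have := h _ ⟨k, ⟨hk1, hk2⟩, rfl⟩
      simp only [root_mul hq y k hk1] at this
      exact this
  rw [hset, ← Measure.map_apply (MeasurableEquiv.measurable _)
    (MeasurableSet.pi (Finset.countable_toSet _) (fun _ _ => MeasurableSet.singleton _))]
  have hcur := Measure.infinitePi_map_curry_symm (ι := ℕ) (κ := List (Fin m)) (X := Fin m)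
    (fun _ u => p.nu u)
  unfold Wts.PP Wts.PL
  rw [hcur, Measure.infinitePi_pi _ (fun _ _ => MeasurableSet.singleton _), Finset.prod_image]
  · rw [ENNReal.ofReal_prod_of_nonneg (fun k _ => p.nn _ _)]
    apply Finset.prod_congr rfl
    intro k hk
    rw [Finset.mem_Icc] at hk
    rw [p.nu_apply]
    simp only [root_mul hq y k hk.1]
  · intro a ha b hb hab
    simp only [Finset.coe_Icc, Set.mem_Icc] at ha hb
    have h1 := root_mul hq y a ha.1
    have h2 := root_mul hq y b hb.1
    simp only [Prod.mk.injEq] at hab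
    rw [← h1, ← h2, hab.1, hab.2]

theorem ae_pos {m : ℕ} (p : Wts m) : ∀ᵐ ω ∂p.PP, ∀ i u, 0 < p.w u (ω i u) := by
  rw [ae_all_iff]; intro i
  rw [ae_all_iff]; intro u
  have h1 : ∀ᵐ j ∂p.nu u, 0 < p.w u j := by
    rw [ae_iff, ← nonpos_iff_eq_zero]
    have : {a | ¬ 0 < p.w u a} ⊆ ⋃ j ∈ (Finset.univ.filter fun j => ¬ 0 < p.w u j), {j} := by
      intro a ha
      simpa using ha
    refine (measure_mono this).trans ((measure_biUnion_finset_le _ _).trans ?_)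
    rw [Finset.sum_eq_zero]
    intro j hj
    rw [p.nu_apply, ENNReal.ofReal_eq_zero]
    simpa using hj
  have h2 : ∀ᵐ c ∂p.PL, 0 < p.w u (c u) :=
    (measurePreserving_eval_infinitePi (fun u => p.nu u) u).quasiMeasurePreserving.ae h1
  exact (measurePreserving_eval_infinitePi (fun _ : ℕ => p.PL) i).quasiMeasurePreserving.ae h2

theorem measurableSet_rwd {m q : ℕ} (hq : 2 ≤ q) (k : ℕ) (hk : 0 < k) :
    ∀ u : List (Fin m), MeasurableSet {ω : ℕ → List (Fin m) → Fin m | rwd q ω k = u} := by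
  induction k using Nat.strong_induction_on with
  | _ k ih =>
    intro u
    have hm : ∀ (v : List (Fin m)) (a : Fin m),
        MeasurableSet {ω : ℕ → List (Fin m) → Fin m | ω (rootQ q k) v = a} := by
      intro v a
      have : Measurable (fun ω : ℕ → List (Fin m) → Fin m => ω (rootQ q k) v) := by fun_prop
      exact this (MeasurableSet.singleton a)
    rcases List.eq_nil_or_concat u with rfl | ⟨v, a, rfl⟩
    · convert MeasurableSet.empty
      rw [Set.eq_empty_iff_forall_notMem]
      intro ω hω
      rw [Set.mem_ofPred_eq, rwd] at hω
      split_ifs at hω <;> simp at hω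
    · by_cases hd : q ∣ k
      · have h1 : 0 < k / q := Nat.div_pos (Nat.le_of_dvd hk hd) (by omega)
        convert (ih _ (Nat.div_lt_self hk hq) h1 v).inter (hm v a) using 1
        ext ω
        rw [Set.mem_ofPred_eq, rwd, dif_pos ⟨hq, hk, hd⟩]
        simp only [Set.mem_inter_iff, Set.mem_ofPred_eq, List.concat_eq_append]
        constructor
        · intro h
          have := List.append_inj' h rfl
          obtain ⟨h1, h2⟩ := this
          subst h1
          simpa using h2
        · rintro ⟨h1, h2⟩
          rw [h1, h2]
      · by_cases hv : v = []
        · subst hv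
          convert hm [] a using 1
          ext ω
          rw [Set.mem_ofPred_eq, rwd, dif_neg (by tauto)]
          simp
        · convert MeasurableSet.empty
          rw [Set.eq_empty_iff_forall_notMem]
          intro ω hω
          rw [Set.mem_ofPred_eq, rwd, dif_neg (by tauto)] at hω
          apply hv
          have := congrArg List.length hω
          simp at this
          exact this

theorem measurable_xw {m q : ℕ} (hq : 2 ≤ q) (k : ℕ) (hk : 0 < k) :
    Measurable (fun ω : ℕ → List (Fin m) → Fin m => xw q ω k) := by
  apply measurable_to_countable'
  intro a
  have : (fun ω : ℕ → List (Fin m) → Fin m => xw q ω k) ⁻¹' {a} =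
      ⋃ v : List (Fin m), {ω | rwd q ω k = v ++ [a]} := by
    ext ω
    simp only [Set.mem_preimage, Set.mem_singleton_iff, Set.mem_iUnion, Set.mem_ofPred_eq]
    rw [← wd_xw hq ω k hk, wd_eq hq _ hk]
    constructor
    · intro h; exact ⟨_, by rw [h]⟩
    · rintro ⟨v, h⟩
      have := (List.append_inj' h rfl).2
      simpa using this
  rw [this]
  exact MeasurableSet.iUnion fun v => measurableSet_rwd hq k hk _

theorem measurableSet_Wc {m : ℕ} (l : ℕ) :
    ∀ u : List (Fin m), MeasurableSet {c : List (Fin m) → Fin m | Wc c l = u} := by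
  induction l with
  | zero => intro u; simp only [Wc]; exact MeasurableSet.const _
  | succ l ih =>
    intro u
    rcases List.eq_nil_or_concat u with rfl | ⟨v, a, rfl⟩
    · convert MeasurableSet.empty
      rw [Set.eq_empty_iff_forall_notMem]
      intro c hc
      simp [Wc] at hc
    · have hm : MeasurableSet {c : List (Fin m) → Fin m | c v = a} := by
        have h : Measurable (fun c : List (Fin m) → Fin m => c v) := measurable_pi_apply v
        exact h (MeasurableSet.singleton a)
      convert (ih v).inter hm using 1
      ext c
      simp only [Wc, Set.mem_inter_iff, Set.mem_ofPred_eq, List.concat_eq_append]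
      constructor
      · intro h
        obtain ⟨h1, h2⟩ := List.append_inj' h rfl
        subst h1
        simpa using h2
      · rintro ⟨h1, h2⟩
        rw [h1, h2]

theorem measurable_Wc {m : ℕ} (G : List (Fin m) → ℝ) (l : ℕ) :
    Measurable (fun c : List (Fin m) → Fin m => G (Wc c l)) := by
  intro s _
  have : (fun c : List (Fin m) → Fin m => G (Wc c l)) ⁻¹' s =
      ⋃ u ∈ (G ⁻¹' s), {c : List (Fin m) → Fin m | Wc c l = u} := by
    ext c; simp
  rw [this]
  exact MeasurableSet.biUnion (Set.to_countable _) fun u _ => measurableSet_Wc l u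

theorem slln {m : ℕ} (p : Wts m) (f : (List (Fin m) → Fin m) → ℝ) (hf : Measurable f) (C : ℝ)
    (hC : ∀ c, |f c| ≤ C) (g : ℕ → ℕ) (hg : Function.Injective g) :
    ∀ᵐ ω ∂p.PP, Tendsto (fun n : ℕ => (∑ i ∈ Finset.range n, f (ω (g i))) / n) atTop
      (𝓝 (∫ c, f c ∂p.PL)) := by
  have hmp : ∀ i : ℕ, MeasurePreserving (fun ω : ℕ → List (Fin m) → Fin m => ω i) p.PP p.PL :=
    fun i => measurePreserving_eval_infinitePi (fun _ : ℕ => p.PL) i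
  have hmeas : ∀ i : ℕ, Measurable (fun ω : ℕ → List (Fin m) → Fin m => f (ω i)) :=
    fun i => hf.comp (measurable_pi_apply i)
  have hind : ProbabilityTheory.iIndepFun
      (fun (i : ℕ) (ω : ℕ → List (Fin m) → Fin m) => f (ω i)) p.PP :=
    ProbabilityTheory.iIndepFun_infinitePi (P := fun _ : ℕ => p.PL) (X := fun _ => f)
      (fun _ => hf)
  have := ProbabilityTheory.strong_law_ae_real (μ := p.PP) (fun i ω => f (ω (g i)))
    (Integrable.of_bound (hmeas _).aestronglyMeasurable C
      (Eventually.of_forall fun ω => by simpa using hC _))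
    (fun i j hij => hind.indepFun (hg.ne hij))
    (fun i => ⟨(hmeas _).aemeasurable, (hmeas _).aemeasurable, by
      have e : ∀ i : ℕ, Measure.map (fun ω : ℕ → List (Fin m) → Fin m => f (ω i)) p.PP
          = Measure.map f p.PL := by
        intro i
        rw [← (hmp i).map_eq, Measure.map_map hf (measurable_pi_apply i)]
        rfl
      rw [e, e]⟩)
  have hi : ∫ ω, f (ω (g 0)) ∂p.PP = ∫ c, f c ∂p.PL := by
    rw [← (hmp (g 0)).map_eq, integral_map (measurable_pi_apply _).aemeasurable
      hf.aestronglyMeasurable]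
  rw [hi] at this
  exact this

/-! ### Averages -/

theorem tendsto_div_cast {d : ℕ} (hd : 0 < d) :
    Tendsto (fun n : ℕ => ((n / d : ℕ) : ℝ) / n) atTop (𝓝 ((d : ℝ)⁻¹)) := by
  have hd' : (0 : ℝ) < d := by exact_mod_cast hd
  have h1 : Tendsto (fun n : ℕ => (d : ℝ)⁻¹ - 1 / (n : ℝ)) atTop (𝓝 ((d : ℝ)⁻¹)) := by
    simpa using (tendsto_const_nhds (x := (d : ℝ)⁻¹)).sub (tendsto_one_div_atTop_nhds_zero_nat (𝕜 := ℝ))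
  refine tendsto_of_tendsto_of_tendsto_of_le_of_le' h1 tendsto_const_nhds ?_ ?_
  · filter_upwards [eventually_gt_atTop 0] with n hn
    have hn' : (0 : ℝ) < n := by exact_mod_cast hn
    have h2 : (n : ℝ) < d * ((n / d : ℕ) + 1) := by
      exact_mod_cast Nat.lt_mul_div_succ n hd
    rw [le_div_iff₀ hn', sub_mul, one_div, inv_mul_cancel₀ hn'.ne', inv_mul_eq_div,
      sub_le_iff_le_add, div_le_iff₀ hd']
    linarith
  · filter_upwards [eventually_gt_atTop 0] with n hn
    have hn' : (0 : ℝ) < n := by exact_mod_cast hn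
    rw [div_le_iff₀ hn', inv_mul_eq_div]
    exact Nat.cast_div_le

theorem tendsto_avg_div (A : ℕ → ℝ) (r : ℝ) {d : ℕ} (hd : 0 < d)
    (h : Tendsto (fun n : ℕ => A n / n) atTop (𝓝 r)) :
    Tendsto (fun n : ℕ => A (n / d) / n) atTop (𝓝 (r * (d : ℝ)⁻¹)) := by
  have h1 : Tendsto (fun n : ℕ => n / d) atTop atTop :=
    Nat.tendsto_div_const_atTop hd.ne'
  have h2 := (h.comp h1).mul (tendsto_div_cast hd)
  refine h2.congr' ?_
  filter_upwards [eventually_ge_atTop d] with n hn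
  have h3 : 0 < n / d := Nat.div_pos hn hd
  have h4 : ((n / d : ℕ) : ℝ) ≠ 0 := by exact_mod_cast h3.ne'
  simp only [Function.comp]
  field_simp

theorem sum_Icc_range (F : ℕ → ℝ) (n : ℕ) :
    ∑ k ∈ Finset.Icc 1 n, F k = ∑ k ∈ Finset.range n, F (k + 1) := by
  rw [Finset.range_eq_Ico, Finset.sum_Ico_add' F 0 n 1]
  rfl

theorem avg_tendsto {m q : ℕ} (hq : 2 ≤ q) (p : Wts m) (G : List (Fin m) → ℝ) (C : ℝ)
    (hG0 : ∀ u, 0 ≤ G u) (hGC : ∀ u, G u ≤ C) :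
    ∀ᵐ ω ∂p.PP, ∃ a, Tendsto
      (fun n : ℕ => (∑ k ∈ Finset.Icc 1 n, G (wd q (xw q ω) k)) / n) atTop (𝓝 a) := by
  have hqp : 0 < q := by omega
  have hq1 : (1 : ℝ) < q := by exact_mod_cast hq
  have hC0 : 0 ≤ C := (hG0 []).trans (hGC [])
  have hbd : ∀ l (c : List (Fin m) → Fin m), |G (Wc c (l + 1))| ≤ C := fun l c => by
    rw [abs_of_nonneg (hG0 _)]; exact hGC _
  have H1 : ∀ᵐ ω ∂p.PP, ∀ l : ℕ, Tendsto
      (fun n : ℕ => (∑ i ∈ Finset.range n, G (Wc (ω (i + 1)) (l + 1))) / n) atTop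
      (𝓝 (∫ c, G (Wc c (l + 1)) ∂p.PL)) := by
    rw [ae_all_iff]; intro l
    exact slln p (fun c => G (Wc c (l + 1))) (measurable_Wc G _) C (hbd l) (fun i => i + 1)
      (fun a b h => by simpa using h)
  have H2 : ∀ᵐ ω ∂p.PP, ∀ l : ℕ, Tendsto
      (fun n : ℕ => (∑ i ∈ Finset.range n, G (Wc (ω (q * (i + 1))) (l + 1))) / n) atTop
      (𝓝 (∫ c, G (Wc c (l + 1)) ∂p.PL)) := by
    rw [ae_all_iff]; intro l
    refine slln p (fun c => G (Wc c (l + 1))) (measurable_Wc G _) C (hbd l)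
      (fun i => q * (i + 1)) (fun a b h => ?_)
    have := Nat.eq_of_mul_eq_mul_left hqp h
    omega
  filter_upwards [H1, H2] with ω h1 h2
  set R : ℕ → ℕ → ℝ := fun l N =>
    ∑ k ∈ (Finset.Icc 1 N).filter (fun k => ¬ q ∣ k), G (Wc (ω k) (l + 1)) with hR
  have hRlim : ∀ l, ∃ r, Tendsto (fun n : ℕ => R l (n / q ^ l) / n) atTop (𝓝 r) := by
    intro l
    have e : ∀ N : ℕ, R l N / N = (∑ i ∈ Finset.range N, G (Wc (ω (i + 1)) (l + 1))) / N
        - (∑ i ∈ Finset.range (N / q), G (Wc (ω (q * (i + 1))) (l + 1))) / N := by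
      intro N
      have := sum_split hq (fun k => G (Wc (ω k) (l + 1))) N
      rw [sum_Icc_range, sum_Icc_range] at this
      rw [this, ← sub_div, add_sub_cancel_right]
    have h3 := ((h1 l).sub (tendsto_avg_div
      (fun N => ∑ i ∈ Finset.range N, G (Wc (ω (q * (i + 1))) (l + 1))) _ hqp (h2 l))).congr
        (fun N => (e N).symm)
    exact ⟨_, tendsto_avg_div (R l) _ (pow_pos hqp l) h3⟩
  choose r hr using hRlim
  refine ⟨∑' l, r l, ?_⟩
  have key := tendsto_tsum_of_dominated_convergence (𝓕 := atTop)
    (f := fun (n : ℕ) l => R l (n / q ^ l) / n) (g := r)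
    (bound := fun l => C * ((q : ℝ)⁻¹) ^ l)
    ((summable_geometric_of_lt_one (by positivity) (inv_lt_one_of_one_lt₀ hq1)).mul_left C)
    hr (by
      filter_upwards [eventually_gt_atTop 0] with n hn l
      have hn' : (0 : ℝ) < n := by exact_mod_cast hn
      have hR0 : 0 ≤ R l (n / q ^ l) := Finset.sum_nonneg fun _ _ => hG0 _
      have hRC : R l (n / q ^ l) ≤ ((n / q ^ l : ℕ) : ℝ) * C := by
        calc R l (n / q ^ l) ≤ ∑ k ∈ Finset.Icc 1 (n / q ^ l), G (Wc (ω k) (l + 1)) :=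
              Finset.sum_le_sum_of_subset_of_nonneg (Finset.filter_subset _ _)
                (fun _ _ _ => hG0 _)
          _ ≤ ∑ k ∈ Finset.Icc 1 (n / q ^ l), C := Finset.sum_le_sum fun _ _ => hGC _
          _ = _ := by simp
      rw [Real.norm_of_nonneg (by positivity), div_le_iff₀ hn']
      refine hRC.trans ?_
      have : ((n / q ^ l : ℕ) : ℝ) ≤ n / (q : ℝ) ^ l := by
        have := @Nat.cast_div_le ℝ _ _ _ n (q ^ l)
        push_cast at this ⊢
        exact this
      calc ((n / q ^ l : ℕ) : ℝ) * C ≤ n / (q : ℝ) ^ l * C := by gcongr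
        _ = _ := by rw [inv_pow]; field_simp)
  refine key.congr' ?_
  filter_upwards with n
  rw [sum_split_iter hq _ n n]
  have hz : n / q ^ n = 0 := Nat.div_eq_of_lt (Nat.lt_pow_self (by omega))
  rw [hz]
  simp only [Finset.Icc_eq_empty_of_lt Nat.zero_lt_one, Finset.sum_empty, add_zero]
  rw [Finset.sum_div, tsum_eq_sum (s := Finset.range n)]
  · apply Finset.sum_congr rfl
    intro l _
    congr 1
    apply Finset.sum_congr rfl
    intro k hk
    obtain ⟨hk1, hk2⟩ := Finset.mem_filter.1 hk
    rw [Finset.mem_Icc] at hk1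
    have : 0 < q ^ l * k := Nat.mul_pos (pow_pos hqp l) hk1.1
    rw [wd_xw hq ω _ this, rwd_pow_mul hq ω k hk2]
  · intro l hl
    rw [Finset.mem_range, not_lt] at hl
    have hz : n / q ^ l = 0 :=
      Nat.div_eq_of_lt (lt_of_le_of_lt hl (Nat.lt_pow_self (by omega)))
    simp [hR, hz]

/-! ### The tree function -/

/-- bounded positive solution of the tree equation. -/
structure TTree {m : ℕ} (q : ℕ) (B : Set (List (Fin m))) (t : List (Fin m) → ℝ) (M : ℝ) :
    Prop where
  nil : [] ∈ B
  ge : ∀ u ∈ B, 1 ≤ t u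
  le : ∀ u ∈ B, t u ≤ M
  eq : ∀ u ∈ B, t u ^ q = ∑ j ∈ Finset.univ.filter (fun j : Fin m => u ++ [j] ∈ B), t (u ++ [j])

/-- transition probabilities built from `t`. -/
def TTree.p {m : ℕ} [NeZero m] {q : ℕ} {B : Set (List (Fin m))} {t : List (Fin m) → ℝ} {M : ℝ}
    (h : TTree q B t M) : Wts m where
  w u j := if u ∈ B then (if u ++ [j] ∈ B then t (u ++ [j]) / t u ^ q else 0)
    else (if j = 0 then 1 else 0)
  nn u j := by
    split_ifs with h1 h2
    · have := h.ge _ h1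
      have := h.ge _ h2
      positivity
    all_goals norm_num
  one u := by
    by_cases h1 : u ∈ B
    · simp only [h1, if_true]
      rw [← Finset.sum_filter, ← Finset.sum_div, ← h.eq u h1]
      have := h.ge _ h1
      exact div_self (by positivity)
    · simp [h1]

/-- `log t`, truncated to zero outside the tree. -/
def lgT {m : ℕ} (B : Set (List (Fin m))) (t : List (Fin m) → ℝ) (u : List (Fin m)) : ℝ :=
  if u ∈ B then Real.log (t u) else 0

/-- partial sums of `log t` along a sequence. -/
def SS {m : ℕ} (q : ℕ) (B : Set (List (Fin m))) (t : List (Fin m) → ℝ) (y : ℕ → Fin m) (n : ℕ) :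
    ℝ := ∑ k ∈ Finset.Icc 1 n, lgT B t (wd q y k)

/-- logarithm of the mass of a cylinder. -/
def LL {m : ℕ} (q : ℕ) (B : Set (List (Fin m))) (t : List (Fin m) → ℝ) (y : ℕ → Fin m) (n : ℕ) :
    ℝ := SS q B t y n - q * (SS q B t y (n / q) + ((n : ℝ) - (n / q : ℕ)) * Real.log (t []))

/-- the sequences all of whose words lie in the tree. -/
def YY {m : ℕ} (q : ℕ) (B : Set (List (Fin m))) : Set (ℕ → Fin m) :=
  {y | ∀ k, 0 < k → wd q y k ∈ B}

section
variable {m : ℕ} [NeZero m] {q : ℕ} {B : Set (List (Fin m))} {t : List (Fin m) → ℝ} {M : ℝ}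

theorem TTree.lgT_nonneg (h : TTree q B t M) (u : List (Fin m)) : 0 ≤ lgT B t u := by
  unfold lgT; split_ifs with h1
  · exact Real.log_nonneg (h.ge u h1)
  · rfl

theorem TTree.lgT_le (h : TTree q B t M) (u : List (Fin m)) : lgT B t u ≤ Real.log M := by
  have h1 := (h.ge _ h.nil).trans (h.le _ h.nil)
  unfold lgT; split_ifs with h2
  · exact Real.log_le_log (by linarith [h.ge _ h2]) (h.le u h2)
  · exact Real.log_nonneg h1

theorem preW_mem (h0 : [] ∈ B) (hq : 2 ≤ q) {y : ℕ → Fin m} (hy : y ∈ YY q B) (k : ℕ)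
    (hk : 0 < k) : preW q y k ∈ B := by
  unfold preW; split_ifs with hd
  · exact hy _ (Nat.div_pos (Nat.le_of_dvd hk hd) (by omega))
  · exact h0

theorem TTree.prod_eq (h : TTree q B t M) (hq : 2 ≤ q) {y : ℕ → Fin m} (hy : y ∈ YY q B)
    (n : ℕ) : ∏ k ∈ Finset.Icc 1 n, h.p.w (preW q y k) (y k) = Real.exp (LL q B t y n) := by
  have e1 : LL q B t y n = ∑ k ∈ Finset.Icc 1 n,
      (lgT B t (wd q y k) - q * lgT B t (preW q y k)) := by
    rw [Finset.sum_sub_distrib, ← Finset.mul_sum, sum_preW hq (lgT B t), LL, SS, SS]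
    simp [lgT, h.nil]
  rw [e1, Real.exp_sum]
  apply Finset.prod_congr rfl
  intro k hk
  have hk1 := (Finset.mem_Icc.1 hk).1
  have m1 := preW_mem h.nil hq hy k hk1
  have m2 := hy k hk1
  have e2 : lgT B t (wd q y k) = Real.log (t (wd q y k)) := by simp [lgT, m2]
  have e3 : lgT B t (preW q y k) = Real.log (t (preW q y k)) := by simp [lgT, m1]
  rw [e2, e3]
  have p1 : 0 < t (preW q y k) := by linarith [h.ge _ m1]
  have p2 : 0 < t (wd q y k) := by linarith [h.ge _ m2]
  rw [Real.exp_sub, Real.exp_log p2, ← Real.log_pow, Real.exp_log (by positivity)]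
  rw [wd_eq hq y hk1] at m2 ⊢
  simp [TTree.p, m1, m2]

theorem TTree.cyl (h : TTree q B t M) (hq : 2 ≤ q) {y : ℕ → Fin m} (hy : y ∈ YY q B)
    (n : ℕ) : h.p.PP {ω | ∀ k, 0 < k → k ≤ n → xw q ω k = y k} =
      ENNReal.ofReal (Real.exp (LL q B t y n)) := by
  rw [cyl_prob hq, h.prod_eq hq hy]

theorem TTree.ae_mem (h : TTree q B t M) (hq : 2 ≤ q) :
    ∀ᵐ ω ∂h.p.PP, xw q ω ∈ YY q B := by
  filter_upwards [ae_pos h.p] with ω hω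
  intro k
  induction k using Nat.strong_induction_on with
  | _ k ih =>
    intro hk
    have hpre : preW q (xw q ω) k ∈ B := by
      unfold preW; split_ifs with hd
      · exact ih _ (Nat.div_lt_self hk hq) (Nat.div_pos (Nat.le_of_dvd hk hd) (by omega))
      · exact h.nil
    rw [wd_eq hq _ hk]
    have := hω (rootQ q k) (preW q (xw q ω) k)
    rw [← xw_eq hq ω k hk] at this
    by_contra hc
    simp [TTree.p, hpre, hc] at this

theorem TTree.ae_lim (h : TTree q B t M) (hq : 2 ≤ q) :
    ∀ᵐ ω ∂h.p.PP, Tendsto (fun n : ℕ => LL q B t (xw q ω) n / n) atTop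
      (𝓝 (-(((q : ℝ) - 1) * Real.log (t [])))) := by
  filter_upwards [avg_tendsto hq h.p (lgT B t) _ h.lgT_nonneg h.lgT_le] with ω hω
  obtain ⟨a, ha⟩ := hω
  have hqp : 0 < q := by omega
  have hq0 : (q : ℝ) ≠ 0 := by exact_mod_cast hqp.ne'
  have h1 := tendsto_avg_div _ _ hqp ha
  have h2 := ((ha.sub (h1.const_mul (q : ℝ))).sub
    (((tendsto_const_nhds (x := (1 : ℝ))).sub (tendsto_div_cast hqp)).const_mul
      (q * Real.log (t []))))
  have e : a - q * (a * (q : ℝ)⁻¹) - q * Real.log (t []) * (1 - (q : ℝ)⁻¹)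
      = -(((q : ℝ) - 1) * Real.log (t [])) := by field_simp; ring
  rw [e] at h2
  refine h2.congr' ?_
  filter_upwards [eventually_gt_atTop 0] with n hn
  have hn' : (n : ℝ) ≠ 0 := by exact_mod_cast hn.ne'
  simp only [LL, SS]
  field_simp
  ring

theorem TTree.upper (h : TTree q B t M) (hq : 2 ≤ q) (y : ℕ → Fin m)
    (ε : ℝ) (hε : 0 < ε) (N : ℕ) :
    ∃ n, N ≤ n ∧ -(n * (((q : ℝ) - 1) * Real.log (t []) + ε)) ≤ LL q B t y n := by
  by_contra! hc
  have hqp : 0 < q := by omega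
  have hq0 : (0 : ℝ) < q := by exact_mod_cast hqp
  set a : ℕ → ℝ := fun j => SS q B t y (q ^ j) / (q : ℝ) ^ j with ha
  have hS : ∀ n, 0 ≤ SS q B t y n := fun n => Finset.sum_nonneg fun _ _ => h.lgT_nonneg _
  have step : ∀ j, N ≤ j → a (j + 1) ≤ a j - ε := by
    intro j hj
    have h1 := hc (q ^ (j + 1)) (hj.trans ((Nat.le_succ j).trans
      (Nat.lt_pow_self (by omega)).le))
    have e : q ^ (j + 1) / q = q ^ j := by
      rw [pow_succ, Nat.mul_div_cancel _ hqp]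
    rw [LL, e] at h1
    push_cast at h1
    simp only [ha]
    have hp : (0 : ℝ) < (q : ℝ) ^ j := by positivity
    generalize SS q B t y (q ^ (j + 1)) = S' at h1 ⊢
    generalize SS q B t y (q ^ j) = S at h1 ⊢
    rw [pow_succ (q : ℝ) j] at h1 ⊢
    rw [div_sub' hp.ne', div_le_div_iff₀ (by positivity) hp]
    have := mul_le_mul_of_nonneg_right h1.le hp.le
    linarith
  have all : ∀ i : ℕ, a (N + i) ≤ a N - i * ε := by
    intro i
    induction i with
    | zero => simp
    | succ i ih =>
      have := step (N + i) (by omega)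
      rw [← add_assoc]
      push_cast
      linarith
  obtain ⟨i, hi⟩ := exists_nat_gt (a N / ε)
  have h3 := all i
  have h4 : 0 ≤ a (N + i) := div_nonneg (hS _) (by positivity)
  rw [div_lt_iff₀ hε] at hi
  linarith

end

/-! ### Digits -/

/-- the integer whose base-`m` digits are `y 1, …, y n`. -/
def KK {m : ℕ} (y : ℕ → Fin m) : ℕ → ℕ
  | 0 => 0
  | n + 1 => m * KK y n + (y (n + 1) : ℕ)

/-- the real number with base-`m` digits `y 1, y 2, …`. -/
def ValN {m : ℕ} (y : ℕ → Fin m) : ℝ :=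
  ∑' k : ℕ, ((y (k + 1) : ℕ) : ℝ) * (m : ℝ)⁻¹ ^ (k + 1)

theorem KK_inj {m : ℕ} (y z : ℕ → Fin m) (n : ℕ) (h : KK y n = KK z n) :
    ∀ k, 0 < k → k ≤ n → y k = z k := by
  induction n with
  | zero => intro k h1 h2; omega
  | succ n ih =>
    simp only [KK] at h
    have hy := (y (n + 1)).2
    have hz := (z (n + 1)).2
    have h1 : (y (n + 1) : ℕ) = z (n + 1) := by
      have := congrArg (· % m) h
      simpa [Nat.add_mod, Nat.mod_eq_of_lt hy, Nat.mod_eq_of_lt hz] using this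
    have h2 : KK y n = KK z n := by
      rw [h1] at h
      exact Nat.eq_of_mul_eq_mul_left (by omega : 0 < m) (Nat.add_right_cancel h)
    intro k hk hkn
    rcases Nat.lt_or_ge k (n + 1) with h3 | h3
    · exact ih h2 k hk (by omega)
    · have : k = n + 1 := by omega
      subst this
      exact Fin.ext h1

theorem KK_congr {m : ℕ} (y z : ℕ → Fin m) (n : ℕ) (h : ∀ k, 0 < k → k ≤ n → y k = z k) :
    KK y n = KK z n := by
  induction n with
  | zero => rfl
  | succ n ih =>
    simp only [KK]
    rw [ih (fun k h1 h2 => h k h1 (by omega)), h (n + 1) (by omega) le_rfl]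

theorem KK_partial {m : ℕ} (hm : 2 ≤ m) (y : ℕ → Fin m) (n : ℕ) :
    ∑ k ∈ Finset.range n, ((y (k + 1) : ℕ) : ℝ) * (m : ℝ)⁻¹ ^ (k + 1) =
      KK y n * (m : ℝ)⁻¹ ^ n := by
  have hm0 : (m : ℝ) ≠ 0 := by positivity
  induction n with
  | zero => simp [KK]
  | succ n ih =>
    rw [Finset.sum_range_succ, ih]
    simp only [KK]
    push_cast
    rw [pow_succ]
    field_simp

theorem val_tendsto {m : ℕ} (hm : 2 ≤ m) (y : ℕ → Fin m) :
    Tendsto (fun n => (KK y n : ℝ) * (m : ℝ)⁻¹ ^ n) atTop (𝓝 (ValN y)) := by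
  have hm1 : (1 : ℝ) < m := by exact_mod_cast hm
  have hs : Summable (fun k : ℕ => ((y (k + 1) : ℕ) : ℝ) * (m : ℝ)⁻¹ ^ (k + 1)) := by
    have hg : Summable (fun k : ℕ => (m : ℝ)⁻¹ ^ k) :=
      summable_geometric_of_lt_one (by positivity) (inv_lt_one_of_one_lt₀ hm1)
    refine Summable.of_nonneg_of_le (fun k => by positivity) (fun k => ?_) hg
    have : ((y (k + 1) : ℕ) : ℝ) ≤ m := by exact_mod_cast (y (k + 1)).2.le
    calc ((y (k + 1) : ℕ) : ℝ) * (m : ℝ)⁻¹ ^ (k + 1) ≤ m * (m : ℝ)⁻¹ ^ (k + 1) := by gcongr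
      _ = (m : ℝ)⁻¹ ^ k := by rw [pow_succ]; field_simp
  have := hs.hasSum.tendsto_sum_nat
  simp_rw [KK_partial hm] at this
  exact this

theorem val_ge {m : ℕ} (hm : 2 ≤ m) (y : ℕ → Fin m) (n : ℕ) :
    (KK y n : ℝ) * (m : ℝ)⁻¹ ^ n ≤ ValN y := by
  have hmono : Monotone (fun n => (KK y n : ℝ) * (m : ℝ)⁻¹ ^ n) := by
    apply monotone_nat_of_le_succ
    intro n
    rw [← KK_partial hm, ← KK_partial hm, Finset.sum_range_succ]
    have : 0 ≤ ((y (n + 1) : ℕ) : ℝ) * (m : ℝ)⁻¹ ^ (n + 1) := by positivity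
    linarith
  exact hmono.ge_of_tendsto (val_tendsto hm y) n

theorem val_le {m : ℕ} (hm : 2 ≤ m) (y : ℕ → Fin m) (n : ℕ) :
    ValN y ≤ ((KK y n : ℝ) + 1) * (m : ℝ)⁻¹ ^ n := by
  have hm1 : (1 : ℝ) < m := by exact_mod_cast hm
  have hanti : Antitone (fun n => ((KK y n : ℝ) + 1) * (m : ℝ)⁻¹ ^ n) := by
    apply antitone_nat_of_succ_le
    intro n
    have h1 : KK y (n + 1) + 1 ≤ m * (KK y n + 1) := by
      have := (y (n + 1)).2
      simp only [KK]; rw [mul_add]; omega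
    have h2 : (KK y (n + 1) : ℝ) + 1 ≤ m * (KK y n + 1) := by exact_mod_cast h1
    calc ((KK y (n + 1) : ℝ) + 1) * (m : ℝ)⁻¹ ^ (n + 1)
        ≤ (m * (KK y n + 1)) * (m : ℝ)⁻¹ ^ (n + 1) := by gcongr
      _ = _ := by rw [pow_succ]; field_simp
  have ht : Tendsto (fun n => ((KK y n : ℝ) + 1) * (m : ℝ)⁻¹ ^ n) atTop (𝓝 (ValN y)) := by
    have := (val_tendsto hm y).add (tendsto_pow_atTop_nhds_zero_of_lt_one
      (r := (m : ℝ)⁻¹) (by positivity) (inv_lt_one_of_one_lt₀ hm1))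
    rw [add_zero] at this
    refine this.congr fun n => by ring
  exact hanti.le_of_tendsto ht n

theorem measurable_val {m q : ℕ} (hm : 2 ≤ m) (hq : 2 ≤ q) :
    Measurable (fun ω : ℕ → List (Fin m) → Fin m => ValN (xw q ω)) := by
  have hK : ∀ n, Measurable (fun ω : ℕ → List (Fin m) → Fin m => KK (xw q ω) n) := by
    intro n
    induction n with
    | zero => simp only [KK]; exact measurable_const
    | succ n ih =>
      simp only [KK]
      have h1 : Measurable (fun ω : ℕ → List (Fin m) → Fin m => (xw q ω (n + 1) : ℕ)) :=
        (measurable_from_top (f := fun j : Fin m => (j : ℕ))).comp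
          (measurable_xw hq (n + 1) (by omega))
      exact (ih.const_mul m).add h1
  refine measurable_of_tendsto_metrizable
    (f := fun n (ω : ℕ → List (Fin m) → Fin m) => (KK (xw q ω) n : ℝ) * (m : ℝ)⁻¹ ^ n) ?_ ?_
  · intro n
    exact ((measurable_from_top (f := fun j : ℕ => (j : ℝ))).comp (hK n)).mul_const _
  · rw [tendsto_pi_nhds]
    intro ω
    exact val_tendsto hm _

theorem exp_eq_rpow {m : ℕ} (hm : 2 ≤ m) (n : ℕ) (d : ℝ) :
    Real.exp (-(n * (d * Real.log m))) = ((m : ℝ)⁻¹ ^ n) ^ d := by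
  have hm0 : (0 : ℝ) < m := by positivity
  rw [Real.rpow_def_of_pos (by positivity), Real.log_pow, Real.log_inv]
  congr 1; ring

/-! ### Upper bound -/

theorem TTree.upper_bound {m : ℕ} [NeZero m] {q : ℕ} {B : Set (List (Fin m))}
    {t : List (Fin m) → ℝ} {M : ℝ} (h : TTree q B t M) (hm : 2 ≤ m) (hq : 2 ≤ q) :
    dimH (ValN '' (YY q B)) ≤ ENNReal.ofReal (((q : ℝ) - 1) * Real.logb m (t [])) := by
  set s := ((q : ℝ) - 1) * Real.logb m (t []) with hs
  have hm1 : (1 : ℝ) < m := by exact_mod_cast hm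
  have hlm : 0 < Real.log m := Real.log_pos hm1
  have hb0 : (0 : ℝ) < (m : ℝ)⁻¹ := by positivity
  have hb1 : (m : ℝ)⁻¹ < 1 := inv_lt_one_of_one_lt₀ hm1
  have hslog : ((q : ℝ) - 1) * Real.log (t []) = s * Real.log m := by
    rw [hs, Real.logb]; field_simp
  refine dimH_le ?_
  intro d hd
  by_contra! hlt
  have hsd : s < d := by
    by_contra! hc
    apply absurd hlt
    rw [not_lt, ← ENNReal.ofReal_coe_nnreal]
    exact ENNReal.ofReal_le_ofReal hc
  have hd0 : (0 : ℝ) ≤ d := d.2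
  set D := (s + d) / 2 with hD
  have hDd : 0 < (d : ℝ) - D := by rw [hD]; linarith
  set θ : ℝ := (m : ℝ)⁻¹ ^ ((d : ℝ) - D) with hθ
  have hθ0 : 0 ≤ θ := by positivity
  have hθ1 : θ < 1 := Real.rpow_lt_one hb0.le hb1 hDd
  let Good : ℕ → Set ℕ := fun n =>
    {K | ∃ y ∈ YY q B, KK y n = K ∧ ((m : ℝ)⁻¹ ^ n) ^ D ≤ Real.exp (LL q B t y n)}
  have hcount : ∀ n, ∑' K : Good n, ENNReal.ofReal (((m : ℝ)⁻¹ ^ n) ^ (d : ℝ))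
      ≤ ENNReal.ofReal (θ ^ n) := by
    intro n
    let A : Good n → Set (ℕ → List (Fin m) → Fin m) := fun K => {ω | KK (xw q ω) n = K}
    have hA : ∀ K : Good n, ENNReal.ofReal (((m : ℝ)⁻¹ ^ n) ^ D) ≤ h.p.PP (A K) := by
      rintro ⟨K, y, hy, hK, hle⟩
      refine (ENNReal.ofReal_le_ofReal hle).trans ?_
      rw [← h.cyl hq hy n]
      apply measure_mono
      intro ω hω
      exact (KK_congr _ _ n hω).trans hK
    have hAm : ∀ K : Good n, MeasurableSet (A K) := by
      rintro ⟨K, y, hy, hK, hle⟩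
      have : A ⟨K, y, hy, hK, hle⟩ = ⋂ k ∈ Finset.Icc 1 n, {ω | xw q ω k = y k} := by
        ext ω
        simp only [Set.mem_iInter, Finset.mem_Icc]
        constructor
        · intro hω k hk
          exact KK_inj _ _ n (Eq.trans hω hK.symm) k hk.1 hk.2
        · intro hω
          exact (KK_congr _ _ n fun k h1 h2 => hω k ⟨h1, h2⟩).trans hK
      rw [this]
      refine Finset.measurableSet_biInter _ fun k hk => ?_
      exact measurable_xw hq k (Finset.mem_Icc.1 hk).1 (MeasurableSet.singleton _)
    have hdis : Pairwise (Function.onFun Disjoint A) := by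
      intro K K' hne
      rw [Function.onFun, Set.disjoint_left]
      intro ω h1 h2
      exact hne (Subtype.ext (Eq.trans (Eq.symm h1) h2))
    have hsum : ∑' K : Good n, h.p.PP (A K) ≤ 1 :=
      (tsum_meas_le_meas_iUnion_of_disjoint h.p.PP hAm hdis).trans prob_le_one
    have e : ((m : ℝ)⁻¹ ^ n) ^ (d : ℝ) = θ ^ n * ((m : ℝ)⁻¹ ^ n) ^ D := by
      rw [hθ, ← Real.rpow_natCast, ← Real.rpow_natCast, ← Real.rpow_mul hb0.le,
        ← Real.rpow_mul hb0.le, ← Real.rpow_mul hb0.le, ← Real.rpow_add hb0]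
      congr 1; ring
    calc ∑' K : Good n, ENNReal.ofReal (((m : ℝ)⁻¹ ^ n) ^ (d : ℝ))
        ≤ ∑' K : Good n, ENNReal.ofReal (θ ^ n) * h.p.PP (A K) := by
          refine ENNReal.tsum_le_tsum fun K => ?_
          rw [e, ENNReal.ofReal_mul (by positivity)]
          gcongr
          exact hA K
      _ = ENNReal.ofReal (θ ^ n) * ∑' K : Good n, h.p.PP (A K) := ENNReal.tsum_mul_left
      _ ≤ ENNReal.ofReal (θ ^ n) * 1 := by gcongr
      _ = _ := mul_one _
  have hdiam : ∀ (n K : ℕ), Metric.ediam (Set.Icc ((K : ℝ) * (m : ℝ)⁻¹ ^ n)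
      (((K : ℝ) + 1) * (m : ℝ)⁻¹ ^ n)) = ENNReal.ofReal ((m : ℝ)⁻¹ ^ n) := by
    intro n K
    rw [Real.ediam_Icc]
    congr 1; ring
  have hmain := Measure.hausdorffMeasure_le_liminf_tsum (β := ℕ)
    (ι := fun N => Σ n : ℕ, Good (N + n)) (d : ℝ) (ValN '' (YY q B)) (l := atTop)
    (fun N => ENNReal.ofReal ((m : ℝ)⁻¹ ^ N))
    (by
      rw [← ENNReal.ofReal_zero]
      exact ENNReal.tendsto_ofReal (tendsto_pow_atTop_nhds_zero_of_lt_one hb0.le hb1))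
    (fun N i => Set.Icc (((i.2 : ℕ) : ℝ) * (m : ℝ)⁻¹ ^ (N + i.1))
      ((((i.2 : ℕ) : ℝ) + 1) * (m : ℝ)⁻¹ ^ (N + i.1)))
    (Eventually.of_forall fun N i => by
      rw [hdiam]
      exact ENNReal.ofReal_le_ofReal
        (pow_le_pow_of_le_one hb0.le hb1.le (Nat.le_add_right _ _)))
    (Eventually.of_forall fun N => by
      rintro _ ⟨y, hy, rfl⟩
      obtain ⟨n, hn, hL⟩ := h.upper hq y ((d - s) / 2 * Real.log m)
        (mul_pos (by linarith) hlm) N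
      obtain ⟨k, rfl⟩ := Nat.exists_eq_add_of_le hn
      rw [Set.mem_iUnion]
      refine ⟨⟨k, KK y (N + k), y, hy, rfl, ?_⟩, val_ge hm y _, val_le hm y _⟩
      rw [← exp_eq_rpow hm]
      apply Real.exp_le_exp.2
      refine le_trans (le_of_eq ?_) hL
      rw [hslog, hD]; ring)
  rw [hd] at hmain
  have hfin : ∑' n : ℕ, ENNReal.ofReal (θ ^ n) ≠ ∞ := by
    rw [← ENNReal.ofReal_tsum_of_nonneg (fun n => by positivity)
      (summable_geometric_of_lt_one hθ0 hθ1)]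
    exact ENNReal.ofReal_ne_top
  apply hfin
  rw [eq_top_iff]
  refine hmain.trans ?_
  refine (liminf_le_liminf (v := fun _ => ∑' n : ℕ, ENNReal.ofReal (θ ^ n))
    (Eventually.of_forall fun N => ?_)).trans (le_of_eq (liminf_const _))
  rw [ENNReal.tsum_sigma']
  refine ENNReal.tsum_le_tsum fun n => ?_
  refine le_trans (le_of_eq ?_) ((hcount (N + n)).trans (ENNReal.ofReal_le_ofReal
    (pow_le_pow_of_le_one hθ0 hθ1.le (Nat.le_add_left _ _))))
  refine tsum_congr fun K => ?_
  rw [hdiam, ENNReal.ofReal_rpow_of_nonneg (by positivity) hd0]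

/-! ### Lower bound -/

theorem TTree.mass {m : ℕ} [NeZero m] {q : ℕ} {B : Set (List (Fin m))}
    {t : List (Fin m) → ℝ} {M : ℝ} (h : TTree q B t M) (hm : 2 ≤ m) (hq : 2 ≤ q) (d : ℝ) (N n : ℕ)
    (hn : N ≤ n) (A : Set (ℕ → List (Fin m) → Fin m))
    (hA : ∀ ω ∈ A, xw q ω ∈ YY q B ∧
      ∀ n, N ≤ n → Real.exp (LL q B t (xw q ω) n) ≤ ((m : ℝ)⁻¹ ^ n) ^ d)
    (s : Set ℝ) (hs : Metric.ediam s ≤ ENNReal.ofReal ((m : ℝ)⁻¹ ^ n)) :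
    ((h.p.PP.restrict A).map (fun ω => ValN (xw q ω))) s ≤
      5 * ENNReal.ofReal (((m : ℝ)⁻¹ ^ n) ^ d) := by
  have hb0 : (0 : ℝ) < (m : ℝ)⁻¹ := by positivity
  have hbn : (0 : ℝ) < (m : ℝ)⁻¹ ^ n := by positivity
  refine (measure_mono subset_closure).trans ?_
  rw [Measure.map_apply (measurable_val hm hq) isClosed_closure.measurableSet,
    Measure.restrict_apply (measurable_val hm hq isClosed_closure.measurableSet)]
  rcases Set.eq_empty_or_nonempty ((fun ω => ValN (xw q ω)) ⁻¹' closure s ∩ A) with he | ⟨ω₀, h0, h0A⟩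
  · rw [he]; simp
  rw [← Metric.ediam_closure] at hs
  set K₀ := KK (xw q ω₀) n with hK₀
  have hdist : ∀ ω : ℕ → List (Fin m) → Fin m, ValN (xw q ω) ∈ closure s →
      |ValN (xw q ω) - ValN (xw q ω₀)| ≤ (m : ℝ)⁻¹ ^ n := by
    intro ω hω
    have := (Metric.edist_le_ediam_of_mem hω h0).trans hs
    rw [edist_dist, ENNReal.ofReal_le_ofReal_iff hbn.le, Real.dist_eq] at this
    exact this
  have hsub : (fun ω => ValN (xw q ω)) ⁻¹' closure s ∩ A ⊆
      ⋃ K ∈ Finset.Icc (K₀ - 2) (K₀ + 2), ({ω | KK (xw q ω) n = K} ∩ A) := by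
    rintro ω ⟨h1, h1A⟩
    simp only [Set.mem_iUnion]
    refine ⟨KK (xw q ω) n, ?_, rfl, h1A⟩
    have h2 := abs_le.1 (hdist ω h1)
    have a1 := val_ge hm (xw q ω) n
    have a2 := val_le hm (xw q ω) n
    have a3 := val_ge hm (xw q ω₀) n
    have a4 := val_le hm (xw q ω₀) n
    have b1 : (KK (xw q ω) n : ℝ) ≤ K₀ + 2 := by
      refine le_of_mul_le_mul_right ?_ hbn
      nlinarith
    have b2 : (K₀ : ℝ) ≤ KK (xw q ω) n + 2 := by
      refine le_of_mul_le_mul_right ?_ hbn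
      nlinarith
    have c1 : KK (xw q ω) n ≤ K₀ + 2 := by exact_mod_cast b1
    have c2 : K₀ ≤ KK (xw q ω) n + 2 := by exact_mod_cast b2
    rw [Finset.mem_Icc]; omega
  have hone : ∀ K, h.p.PP ({ω | KK (xw q ω) n = K} ∩ A) ≤ ENNReal.ofReal (((m : ℝ)⁻¹ ^ n) ^ d) := by
    intro K
    rcases Set.eq_empty_or_nonempty ({ω | KK (xw q ω) n = K} ∩ A) with he | ⟨ω₁, h1, h1A⟩
    · rw [he]; simp
    obtain ⟨h2, h3⟩ := hA ω₁ h1A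
    refine le_trans ?_ (ENNReal.ofReal_le_ofReal (h3 n hn))
    rw [← h.cyl hq h2 n]
    apply measure_mono
    rintro ω ⟨h4, _⟩
    exact KK_inj _ _ n (Eq.trans h4 (Eq.symm h1))
  refine (measure_mono hsub).trans ((measure_biUnion_finset_le _ _).trans ?_)
  refine (Finset.sum_le_sum fun K _ => hone K).trans ?_
  rw [Finset.sum_const, nsmul_eq_mul]
  gcongr
  rw [Nat.card_Icc]
  have : K₀ + 2 + 1 - (K₀ - 2) ≤ 5 := by omega
  exact_mod_cast this

theorem TTree.lower_bound {m : ℕ} [NeZero m] {q : ℕ} {B : Set (List (Fin m))}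
    {t : List (Fin m) → ℝ} {M : ℝ} (h : TTree q B t M) (hm : 2 ≤ m) (hq : 2 ≤ q) :
    ENNReal.ofReal (((q : ℝ) - 1) * Real.logb m (t [])) ≤ dimH (ValN '' (YY q B)) := by
  set s := ((q : ℝ) - 1) * Real.logb m (t []) with hs
  have hm1 : (1 : ℝ) < m := by exact_mod_cast hm
  have hlm : 0 < Real.log m := Real.log_pos hm1
  have hb0 : (0 : ℝ) < (m : ℝ)⁻¹ := by positivity
  have hb1 : (m : ℝ)⁻¹ < 1 := inv_lt_one_of_one_lt₀ hm1
  have hslog : ((q : ℝ) - 1) * Real.log (t []) = s * Real.log m := by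
    rw [hs, Real.logb]; field_simp
  refine ENNReal.le_of_forall_nnreal_lt fun d hd => ?_
  rcases eq_or_ne d 0 with rfl | hd0
  · simp
  have hdpos : (0 : ℝ) < d := by
    have : 0 < d := pos_iff_ne_zero.2 hd0
    exact_mod_cast this
  have hds : (d : ℝ) < s := by
    by_contra! hc
    apply absurd hd
    rw [not_lt, ← ENNReal.ofReal_coe_nnreal]
    exact ENNReal.ofReal_le_ofReal hc
  apply le_dimH_of_hausdorffMeasure_ne_zero
  let A : ℕ → Set (ℕ → List (Fin m) → Fin m) := fun N => {ω | xw q ω ∈ YY q B ∧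
      ∀ n, N ≤ n → Real.exp (LL q B t (xw q ω) n) ≤ ((m : ℝ)⁻¹ ^ n) ^ (d : ℝ)}
  have hcov : ∀ᵐ ω ∂h.p.PP, ω ∈ ⋃ N, A N := by
    filter_upwards [h.ae_mem hq, h.ae_lim hq] with ω h1 h2
    rw [hslog] at h2
    have h3 := h2.eventually_lt_const
      (show -(s * Real.log m) < -(d * Real.log m) by nlinarith)
    obtain ⟨N, hN⟩ := eventually_atTop.1 (h3.and (eventually_gt_atTop 0))
    rw [Set.mem_iUnion]
    refine ⟨N, h1, fun n hn => ?_⟩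
    obtain ⟨h4, h5⟩ := hN n hn
    have hn' : (0 : ℝ) < n := by exact_mod_cast h5
    rw [← exp_eq_rpow hm]
    apply Real.exp_le_exp.2
    rw [div_lt_iff₀ hn'] at h4
    linarith
  obtain ⟨N, hN⟩ : ∃ N, h.p.PP (A N) ≠ 0 := by
    by_contra! hc
    have h1 : h.p.PP (⋃ N, A N) = 0 := measure_iUnion_null hc
    have h2 : h.p.PP Set.univ = 0 := by
      refine le_antisymm ?_ bot_le
      rw [← h1]
      refine measure_mono_ae ?_
      filter_upwards [hcov] with ω hω _ using hω
    simp at h2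
  set ν := (h.p.PP.restrict (A N)).map (fun ω => ValN (xw q ω)) with hν
  have hmass := fun n hn => h.mass hm hq d N n hn (A N) (fun ω hω => hω)
  rw [← hν] at hmass
  set c : ℝ := (5 * (m : ℝ) ^ (d : ℝ))⁻¹ with hc
  have hc0 : 0 < c := by positivity
  have hle : ENNReal.ofReal c • ν ≤ μH[(d : ℝ)] := by
    refine Measure.le_hausdorffMeasure _ _ (ENNReal.ofReal ((m : ℝ)⁻¹ ^ N))
      (ENNReal.ofReal_pos.2 (by positivity)) fun S hS => ?_
    rw [Measure.smul_apply, smul_eq_mul]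
    rcases eq_or_ne (Metric.ediam S) 0 with hz | hz
    · have h1 : ν S = 0 := by
        have htend : Tendsto (fun n : ℕ => 5 * ENNReal.ofReal (((m : ℝ)⁻¹ ^ n) ^ (d : ℝ))) atTop
            (𝓝 0) := by
          have h2 : Tendsto (fun n : ℕ => ((m : ℝ)⁻¹ ^ n) ^ (d : ℝ)) atTop (𝓝 0) := by
            have := (tendsto_pow_atTop_nhds_zero_of_lt_one hb0.le hb1).rpow_const
              (p := (d : ℝ)) (Or.inr hdpos.le)
            rwa [Real.zero_rpow hdpos.ne'] at this
          have h3 := ENNReal.Tendsto.const_mul (a := 5) (ENNReal.tendsto_ofReal h2)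
            (Or.inr (by norm_num))
          simpa using h3
        refine le_antisymm (ge_of_tendsto htend ?_) bot_le
        filter_upwards [eventually_ge_atTop N] with n hn
        exact hmass n hn S (by rw [hz]; exact bot_le)
      rw [h1]; simp
    · have hfin : Metric.ediam S ≠ ∞ := (hS.trans_lt ENNReal.ofReal_lt_top).ne
      set δ := (Metric.ediam S).toReal with hδ
      have hδ0 : 0 < δ := ENNReal.toReal_pos hz hfin
      have hδe : Metric.ediam S = ENNReal.ofReal δ := (ENNReal.ofReal_toReal hfin).symm
      have hδN : δ ≤ (m : ℝ)⁻¹ ^ N := by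
        rw [hδe, ENNReal.ofReal_le_ofReal_iff (by positivity)] at hS
        exact hS
      obtain ⟨n, hn1, hn2⟩ := exists_nat_pow_near_of_lt_one hδ0
        (hδN.trans (pow_le_one₀ hb0.le hb1.le)) hb0 hb1
      have hNn : N ≤ n := by
        have := (pow_lt_pow_iff_right_of_lt_one₀ hb0 hb1).1 (hn1.trans_le hδN)
        omega
      have h1 := hmass n hNn S (by rw [hδe]; exact ENNReal.ofReal_le_ofReal hn2)
      rw [hδe, ENNReal.ofReal_rpow_of_nonneg hδ0.le hdpos.le]
      have h5 : (5 : ℝ≥0∞) = ENNReal.ofReal 5 := by norm_num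
      rw [h5, ← ENNReal.ofReal_mul (by norm_num)] at h1
      refine (mul_le_mul_right h1 _).trans ?_
      rw [← ENNReal.ofReal_mul hc0.le]
      apply ENNReal.ofReal_le_ofReal
      have e : ((m : ℝ)⁻¹ ^ n) ^ (d : ℝ) = (m : ℝ) ^ (d : ℝ) * ((m : ℝ)⁻¹ ^ (n + 1)) ^ (d : ℝ) := by
        rw [← Real.mul_rpow (by positivity) (by positivity)]
        congr 1
        rw [pow_succ]; field_simp
      have h6 : ((m : ℝ)⁻¹ ^ (n + 1)) ^ (d : ℝ) ≤ δ ^ (d : ℝ) :=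
        Real.rpow_le_rpow (by positivity) hn1.le hdpos.le
      have hmd : (0 : ℝ) < (m : ℝ) ^ (d : ℝ) := by positivity
      rw [e, hc]
      calc _ = ((m : ℝ)⁻¹ ^ (n + 1)) ^ (d : ℝ) := by field_simp
        _ ≤ _ := h6
  have h1 : h.p.PP (A N) ≤ ν (ValN '' (YY q B)) := by
    refine le_trans ?_ (Measure.le_map_apply (measurable_val hm hq).aemeasurable _)
    refine le_trans ?_ (Measure.le_restrict_apply _ _)
    apply measure_mono
    intro ω hω
    exact ⟨⟨_, hω.1, rfl⟩, hω⟩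
  have h2 := hle (ValN '' (YY q B))
  rw [Measure.smul_apply, smul_eq_mul] at h2
  intro h0
  rw [h0, nonpos_iff_eq_zero, mul_eq_zero] at h2
  rcases h2 with h2 | h2
  · rw [ENNReal.ofReal_eq_zero] at h2; linarith
  · rw [h2, nonpos_iff_eq_zero] at h1
    exact hN h1

/-! ### Back to the original formulation -/

theorem wd_pow_mul {m q : ℕ} (hq : 2 ≤ q) (y : ℕ → Fin m) (i : ℕ) (hi : ¬ q ∣ i) (l : ℕ) :
    wd q y (q ^ l * i) = List.ofFn (fun j : Fin (l + 1) => y (q ^ (j : ℕ) * i)) := by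
  have hi0 : 0 < i := Nat.pos_of_ne_zero (by rintro rfl; simp at hi)
  induction l with
  | zero => rw [wd]; simp [hi]
  | succ l ih =>
    have h1 : q ∣ q ^ (l+1) * i := by rw [pow_succ', mul_assoc]; exact Dvd.intro _ rfl
    have h2 : 0 < q ^ (l+1) * i := by positivity
    have h3 : q ^ (l + 1) * i / q = q ^ l * i := by
      rw [pow_succ', mul_assoc, Nat.mul_div_cancel_left _ (by omega)]
    rw [wd_eq hq y h2, preW, if_pos h1, h3, ih]
    conv_rhs => rw [List.ofFn_succ_last]
    simp

theorem begins_ofFn {m : ℕ} (z : ℕ+ → Fin m) (n : ℕ) (f : Fin n → Fin m) :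
    Begins z (List.ofFn f) ↔ ∀ j : Fin n, z ⟨(j : ℕ) + 1, Nat.succ_pos _⟩ = f j := by
  unfold Begins
  constructor
  · intro h j
    have := h ⟨j, by simp⟩
    simpa using this
  · intro h j
    have := h ⟨j, by simpa using j.2⟩
    simpa using this

theorem mem_of_prefixes {m : ℕ} {Ω : Set (ℕ+ → Fin m)} (hcl : IsClosed Ω) (z : ℕ+ → Fin m)
    (h : ∀ n : ℕ, ∃ w ∈ Ω, ∀ j : ℕ, j < n + 1 →
      w ⟨j + 1, Nat.succ_pos _⟩ = z ⟨j + 1, Nat.succ_pos _⟩) : z ∈ Ω := by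
  choose w hw hwz using h
  refine hcl.mem_of_tendsto (b := atTop) (f := w) ?_ (Eventually.of_forall hw)
  rw [tendsto_pi_nhds]
  intro k
  refine tendsto_const_nhds.congr' ?_
  filter_upwards [eventually_ge_atTop (k : ℕ)] with n hn
  have hk := k.pos
  have e : (⟨((k : ℕ) - 1) + 1, Nat.succ_pos _⟩ : ℕ+) = k := by
    exact PNat.eq (Nat.sub_add_cancel k.pos)
  have := hwz n ((k : ℕ) - 1) (by omega)
  rw [e] at this
  exact this.symm

theorem xi_eq {m : ℕ} (q : ℕ+) (hq : 2 ≤ (q : ℕ)) (Ω : Set (ℕ+ → Fin m)) (hcl : IsClosed Ω) :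
    XiSet (XOm q Ω) = ValN '' (YY (q : ℕ) (Pref Ω)) := by
  have hval : ∀ (x : ℕ+ → Fin m) (y : ℕ → Fin m), (∀ k : ℕ+, y k = x k) →
      ValMap m x = ValN y := by
    intro x y hxy
    unfold ValMap ValN
    rw [← Equiv.pnatEquivNat.symm.tsum_eq]
    refine tsum_congr fun k => ?_
    rw [← hxy]
    simp
  have hiff : ∀ (x : ℕ+ → Fin m) (y : ℕ → Fin m), (∀ k : ℕ+, y k = x k) →
      (x ∈ XOm q Ω ↔ y ∈ YY (q : ℕ) (Pref Ω)) := by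
    intro x y hxy
    have hR : ∀ (i : ℕ+) (j : ℕ), RestrJ q x i ⟨j + 1, Nat.succ_pos _⟩ = y ((q : ℕ) ^ j * i) := by
      intro i j
      unfold RestrJ
      rw [← hxy]
      simp
    constructor
    · intro hx k hk
      obtain ⟨l, i, hi, rfl⟩ := Nat.exists_eq_pow_mul_and_not_dvd hk.ne' (q : ℕ) (by omega)
      have hi0 : 0 < i := Nat.pos_of_ne_zero (by rintro rfl; simp at hi)
      rw [wd_pow_mul hq y i hi]
      refine ⟨RestrJ q x ⟨i, hi0⟩, hx ⟨i, hi0⟩ (fun hdv => hi (PNat.dvd_iff.1 hdv)), ?_⟩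
      rw [begins_ofFn]
      intro j
      exact hR _ _
    · intro hy i hi
      rw [PNat.dvd_iff] at hi
      refine mem_of_prefixes hcl _ fun n => ?_
      have h1 := hy ((q : ℕ) ^ n * i) (by positivity)
      rw [wd_pow_mul hq y i hi] at h1
      obtain ⟨w, hw, hb⟩ := h1
      rw [begins_ofFn] at hb
      refine ⟨w, hw, fun j hj => ?_⟩
      rw [hR]
      exact hb ⟨j, hj⟩
  ext r
  constructor
  · rintro ⟨x, hx, rfl⟩
    have hxy : ∀ k : ℕ+, (fun k : ℕ => x (Nat.toPNat' k)) (k : ℕ) = x k := by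
      intro k; simp
    exact ⟨fun k : ℕ => x (Nat.toPNat' k), (hiff x (fun k : ℕ => x (Nat.toPNat' k)) hxy).1 hx,
      (hval x (fun k : ℕ => x (Nat.toPNat' k)) hxy).symm⟩
  · rintro ⟨y, hy, rfl⟩
    refine ⟨fun k => y k, (hiff (fun k => y k) y (fun _ => rfl)).2 hy, ?_⟩
    exact (hval (fun k => y k) y (fun _ => rfl)).symm

/-- **Theorem 2.2 (i).** `dim_H(Ξ_Ω) = (q-1) log_m t(∅)`. -/
theorem stmt7 (m : ℕ) (hm : 2 ≤ m) (q : ℕ+) (hq : 2 ≤ (q : ℕ))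
    (Ω : Set (ℕ+ → Fin m)) (hne : Ω.Nonempty) (hcl : IsClosed Ω)
    (t : List (Fin m) → ℝ) (ht : TSol q Ω t) :
    dimH (XiSet (XOm q Ω)) =
      ENNReal.ofReal (((q : ℝ) - 1) * Real.logb m (t [])) := by
  have : NeZero m := ⟨by omega⟩
  have h : TTree (q : ℕ) (Pref Ω) t ((m : ℝ) ^ ((1 : ℝ) / ((q : ℝ) - 1))) :=
    { nil := by
        obtain ⟨x, hx⟩ := hne
        exact ⟨x, hx, fun j => j.elim0⟩
      ge := fun u hu => (ht u hu).1.1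
      le := fun u hu => (ht u hu).1.2
      eq := fun u hu => (ht u hu).2 }
  rw [xi_eq q hq Ω hcl]
  exact le_antisymm (h.upper_bound hm hq) (h.lower_bound hm hq)
end
end
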